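/- There exists an infinite-dimensional real Banach space X of the form X = C(K), where K is a compact Hausdorff space, such that every injective bounded linear operator T : X → X is surjective (and hence, by the open mapping theorem, an isomorphism of X onto itself). -/

import Mathlib

namespace CKInj

open Filter Topology Set

section FA

variable {E : Type*} [NormedAddCommGroup E] [NormedSpace ℝ E]

/-- properness on bounded sets -/
def Pr (B : E →L[ℝ] E) : Prop :=
  ∀ f : ℕ → E, (∃ C, ∀ n, ‖f n‖ ≤ C) → (∃ y, Tendsto (fun n => B (f n)) atTop (𝓝 y)) →
    ∃ φ : ℕ → ℕ, StrictMono φ ∧ ∃ z, Tendsto (f ∘ φ) atTop (𝓝 z)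

def FinRk (F : E →L[ℝ] E) : Prop := FiniteDimensional ℝ F.toLinearMap.range

theorem Pr.bddBelow {B : E →L[ℝ] E} (h : Pr B) (hi : Function.Injective B) :
    ∃ c > 0, ∀ x, c * ‖x‖ ≤ ‖B x‖ := by
  by_contra hcon
  push Not at hcon
  have h1 : ∀ n : ℕ, ∃ u : E, ‖u‖ = 1 ∧ ‖B u‖ < 1 / ((n : ℝ) + 1) := by
    intro n
    obtain ⟨x, hx⟩ := hcon (1 / ((n : ℝ) + 1)) (by positivity)
    have hx0 : x ≠ 0 := by
      rintro rfl
      simp at hx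
    have hn : 0 < ‖x‖ := norm_pos_iff.2 hx0
    refine ⟨(‖x‖)⁻¹ • x, ?_, ?_⟩
    · rw [norm_smul, norm_inv, norm_norm, inv_mul_cancel₀ hn.ne']
    · rw [map_smul, norm_smul, norm_inv, norm_norm, inv_mul_lt_iff₀ hn]
      linarith [mul_comm (‖x‖) (1 / ((n : ℝ) + 1))]
  choose u hu1 hu2 using h1
  have ht : Tendsto (fun n => B (u n)) atTop (𝓝 0) := by
    rw [tendsto_zero_iff_norm_tendsto_zero]
    exact squeeze_zero (fun _ => norm_nonneg _) (fun n => (hu2 n).le)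
      tendsto_one_div_add_atTop_nhds_zero_nat
  obtain ⟨φ, hφ, z, hz⟩ := h u ⟨1, fun n => (hu1 n).le⟩ ⟨0, ht⟩
  have hBz : Tendsto (fun n => B (u (φ n))) atTop (𝓝 (B z)) := (B.continuous.tendsto z).comp hz
  have hB0 : B z = 0 := tendsto_nhds_unique hBz (ht.comp hφ.tendsto_atTop)
  have hz0 : z = 0 := hi (by simp [hB0])
  have hn : Tendsto (fun n => ‖u (φ n)‖) atTop (𝓝 ‖z‖) := hz.norm
  simp only [hu1] at hn
  have := tendsto_nhds_unique hn tendsto_const_nhds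
  simp [hz0] at this

theorem Pr.add_finRk {B F : E →L[ℝ] E} (h : Pr B) (hF : FinRk F) : Pr (B + F) := by
  intro f ⟨C, hC⟩ ⟨y, hy⟩
  have : FiniteDimensional ℝ F.toLinearMap.range := hF
  have : ProperSpace F.toLinearMap.range := FiniteDimensional.proper ℝ _
  let g : ℕ → F.toLinearMap.range := fun n => ⟨F (f n), ⟨f n, rfl⟩⟩
  have hg : ∀ n, g n ∈ Metric.closedBall (0 : F.toLinearMap.range) (‖F‖ * C) := by
    intro n
    rw [mem_closedBall_zero_iff]
    exact (F.le_opNorm _).trans (mul_le_mul_of_nonneg_left (hC n) (norm_nonneg _))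
  obtain ⟨a, -, φ, hφ, ha⟩ := tendsto_subseq_of_bounded Metric.isBounded_closedBall hg
  have ha' : Tendsto (fun n => F (f (φ n))) atTop (𝓝 (a : E)) :=
    (continuous_subtype_val.tendsto a).comp ha
  have hb : Tendsto (fun n => B (f (φ n))) atTop (𝓝 (y - a)) := by
    have := (hy.comp hφ.tendsto_atTop).sub ha'
    refine this.congr (fun n => ?_)
    simp
  obtain ⟨ψ, hψ, z, hz⟩ := h (f ∘ φ) ⟨C, fun n => hC _⟩ ⟨_, hb⟩
  exact ⟨φ ∘ ψ, hφ.comp hψ, z, hz⟩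

theorem Pr.finite_ker {B : E →L[ℝ] E} (h : Pr B) : FiniteDimensional ℝ B.toLinearMap.ker := by
  refine FiniteDimensional.of_isCompact_closedBall₀ ℝ (r := 1) one_pos ?_
  apply IsSeqCompact.isCompact
  intro f hf
  have hf' : ∀ n, ‖(f n : E)‖ ≤ 1 := fun n => by
    have := hf n
    rwa [mem_closedBall_zero_iff] at this
  obtain ⟨φ, hφ, z, hz⟩ := h (fun n => (f n : E)) ⟨1, hf'⟩ ⟨0, by
    have : (fun n => B (f n : E)) = fun _ => 0 := by
      funext n
      exact (f n).2
    rw [this]; exact tendsto_const_nhds⟩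
  have hzk : z ∈ B.toLinearMap.ker := by
    have h1 : Tendsto (fun n => B ((f (φ n) : E))) atTop (𝓝 (B z)) :=
      (B.continuous.tendsto z).comp hz
    have h2 : (fun n => B (f (φ n) : E)) = fun _ => 0 := by
      funext n
      exact (f _).2
    rw [h2] at h1
    exact tendsto_nhds_unique h1 tendsto_const_nhds
  refine ⟨⟨z, hzk⟩, ?_, φ, hφ, ?_⟩
  · rw [mem_closedBall_zero_iff]
    exact le_of_tendsto hz.norm (Eventually.of_forall fun n => hf' _)
  · rw [tendsto_subtype_rng]
    exact hz

def Neg (B : E →L[ℝ] E) : Prop :=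
  ∃ F : E →L[ℝ] E, FinRk F ∧ (∃ c > 0, ∀ x, c * ‖x‖ ≤ ‖(B + F) x‖) ∧
    ¬ Function.Surjective (B + F)

def NonNeg (B : E →L[ℝ] E) : Prop :=
  ∃ F : E →L[ℝ] E, FinRk F ∧ Function.Surjective (B + F)

theorem Pr.neg_or {B : E →L[ℝ] E} (h : Pr B) : Neg B ∨ NonNeg B := by
  have := h.finite_ker
  set N := B.toLinearMap.ker with hN
  obtain ⟨Q, hQ⟩ := Submodule.exists_isCompl B.toLinearMap.range
  obtain ⟨π, hπ⟩ := Submodule.ClosedComplemented.of_finiteDimensional (𝕜 := ℝ) N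
  have key : ∀ l : N →ₗ[ℝ] Q, ∃ F : E →L[ℝ] E, FinRk F ∧ ∀ x, F x = (l (π x) : E) := by
    intro l
    refine ⟨(LinearMap.toContinuousLinearMap (Q.subtype ∘ₗ l)).comp π, ?_, fun x => rfl⟩
    unfold FinRk
    have : ((LinearMap.toContinuousLinearMap (Q.subtype ∘ₗ l)).comp π).toLinearMap.range
      ≤ (Q.subtype ∘ₗ l).range := by
      rintro _ ⟨x, rfl⟩
      exact ⟨π x, rfl⟩
    exact Submodule.finiteDimensional_of_le this
  rcases le_total (Module.rank ℝ N) (Module.rank ℝ Q) with hr | hr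
  · obtain ⟨l, hl⟩ := rank_le_iff_exists_linearMap.1 hr
    obtain ⟨F, hF, hFx⟩ := key l
    by_cases hs : Function.Surjective (B + F)
    · exact Or.inr ⟨F, hF, hs⟩
    · refine Or.inl ⟨F, hF, (h.add_finRk hF).bddBelow ?_, hs⟩
      rw [injective_iff_map_eq_zero]
      intro x hx
      have hx' : B x + (l (π x) : E) = 0 := by rw [← hFx]; exact hx
      have h1 : (l (π x) : E) ∈ B.toLinearMap.range :=
        ⟨-x, by
          have : -B x = (l (π x) : E) := by rw [neg_eq_iff_add_eq_zero]; exact hx'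
          simpa using this⟩
      have h0 : (l (π x) : E) = 0 := by
        have := hQ.disjoint.le_bot ⟨h1, (l (π x)).2⟩
        simpa using this
      have hBx : B x = 0 := by simpa [h0] using hx'
      have hπx : π x = 0 := hl (by rw [map_zero]; exact Subtype.ext h0)
      have := hπ ⟨x, hBx⟩
      rw [hπx] at this
      exact (congrArg Subtype.val this).symm
  · obtain ⟨j, hj⟩ := rank_le_iff_exists_linearMap.1 hr
    obtain ⟨l, hl⟩ := j.exists_leftInverse_of_injective (LinearMap.ker_eq_bot.2 hj)
    obtain ⟨F, hF, hFx⟩ := key l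
    refine Or.inr ⟨F, hF, fun y => ?_⟩
    have hy : y ∈ B.toLinearMap.range ⊔ Q := by rw [hQ.sup_eq_top]; trivial
    obtain ⟨_, ⟨x, rfl⟩, q, hq, rfl⟩ := Submodule.mem_sup.1 hy
    let n : N := j ⟨q, hq⟩
    have hln : l n = ⟨q, hq⟩ := LinearMap.congr_fun hl _
    refine ⟨x - (π x : E) + (n : E), ?_⟩
    have e1 : B (x - (π x : E) + (n : E)) = B x := by
      have a1 : B (π x : E) = 0 := (π x).2
      have a2 : B (n : E) = 0 := n.2
      simp [a1, a2]
    have e2 : F (x - (π x : E) + (n : E)) = q := by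
      rw [hFx]
      have : π (x - (π x : E) + (n : E)) = n := by
        rw [map_add, map_sub, hπ, hπ]; simp
      rw [this, hln]
    change B _ + F _ = B x + q
    rw [e1, e2]

variable [CompleteSpace E]

theorem surj_perturb {A A' : E →L[ℝ] E} {M : ℝ} (hM : 0 < M)
    (hA : ∀ y, ∃ x, A x = y ∧ ‖x‖ ≤ M * ‖y‖) (hd : ‖A' - A‖ < M⁻¹) : Function.Surjective A' := by
  choose g hg1 hg2 using hA
  let S : A.NonlinearRightInverse := ⟨g, ⟨M, hM.le⟩, hg2, hg1⟩
  have happ : ApproximatesLinearOn (A' : E → E) A univ ‖A' - A‖₊ := by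
    intro x _ y _
    have := (A' - A).le_opNorm (x - y)
    calc ‖A' x - A' y - A (x - y)‖ = ‖(A' - A) (x - y)‖ := by
          congr 1; simp
      _ ≤ _ := this
  intro y
  set r := M⁻¹ - ‖A' - A‖ with hr
  have hr0 : 0 < r := by linarith
  have := happ.surjOn_closedBall_of_nonlinearRightInverse S (ε := ‖y‖ / r) (b := 0)
    (by positivity) (subset_univ _)
  have hy : y ∈ Metric.closedBall (A' 0) (((S.nnnorm : ℝ)⁻¹ - ‖A' - A‖₊) * (‖y‖ / r)) := by
    have e : ((S.nnnorm : ℝ)⁻¹ - ‖A' - A‖₊) = r := rfl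
    rw [e, map_zero, mem_closedBall_zero_iff, mul_div_cancel₀ _ hr0.ne']
  obtain ⟨x, -, hx⟩ := this hy
  exact ⟨x, hx⟩

theorem not_both {G F' : E →L[ℝ] E} (hG : FinRk G) (hF' : FinRk F') {B : E →L[ℝ] E}
    (hi : Function.Injective (B + F')) (hs : Function.Surjective (B + G)) :
    Function.Surjective (B + F') := by
  obtain ⟨R, hR⟩ := (B + G).toLinearMap.exists_rightInverse_of_surjective
    (LinearMap.range_eq_top.2 hs)
  have hR' : ∀ y, B (R y) + G (R y) = y := fun y => LinearMap.congr_fun hR y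
  -- H = G R - F' R
  let H : E →ₗ[ℝ] E := (G.toLinearMap - F'.toLinearMap) ∘ₗ R
  have hH : ∀ y, (B + F') (R y) = y - H y := by
    intro y
    have := hR' y
    change B (R y) + F' (R y) = y - (G (R y) - F' (R y))
    rw [← sub_eq_zero]
    have e : B (R y) + F' (R y) - (y - (G (R y) - F' (R y))) = (B (R y) + G (R y)) - y := by abel
    rw [e, this, sub_self]
  have hRi : Function.Injective R := fun a b hab => by
    rw [← hR' a, ← hR' b, hab]
  have : FiniteDimensional ℝ G.toLinearMap.range := hG
  have : FiniteDimensional ℝ F'.toLinearMap.range := hF'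
  set V := G.toLinearMap.range ⊔ F'.toLinearMap.range
  have hHV : ∀ y, H y ∈ V := fun y => by
    refine V.sub_mem ?_ ?_
    · exact Submodule.mem_sup_left ⟨_, rfl⟩
    · exact Submodule.mem_sup_right ⟨_, rfl⟩
  let L : V →ₗ[ℝ] V := (LinearMap.id - H).restrict (p := V) (q := V)
    (fun x hx => V.sub_mem hx (hHV x))
  have hL : ∀ v : V, (L v : E) = v - H v := fun v => rfl
  have hLi : Function.Injective L := by
    intro a b hab
    have h1 : (B + F') (R a) = (B + F') (R b) := by
      rw [hH, hH, ← hL, ← hL, hab]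
    exact Subtype.ext (hRi (hi h1))
  have hLs := LinearMap.injective_iff_surjective.1 hLi
  intro y
  obtain ⟨v, hv⟩ := hLs ⟨H y, hHV y⟩
  refine ⟨R (y + v), ?_⟩
  rw [hH, map_add]
  have : (v : E) - H v = H y := by rw [← hL, hv]
  rw [← this]; abel

theorem path_surj {T : E →L[ℝ] E} (hT : Function.Injective T)
    (hPr : ∀ s : ℝ, 0 ≤ s → Pr (T + s • ContinuousLinearMap.id ℝ E)) :
    Function.Surjective T := by
  by_contra hns
  let P : ℝ → E →L[ℝ] E := fun s => T + s • ContinuousLinearMap.id ℝ E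
  have hdist : ∀ s t F, ‖(P t + F) - (P s + F)‖ ≤ |t - s| := by
    intro s t F
    have : (P t + F) - (P s + F) = (t - s) • ContinuousLinearMap.id ℝ E := by
      simp only [P]; rw [sub_smul]; abel
    rw [this, norm_smul, Real.norm_eq_abs]
    exact mul_le_of_le_one_right (abs_nonneg _) ContinuousLinearMap.norm_id_le
  have hU : IsOpen {s | Neg (P s)} := by
    rw [Metric.isOpen_iff]
    rintro s ⟨F, hF, ⟨c, hc, hb⟩, hs⟩
    refine ⟨c / 2, by positivity, fun t ht => ⟨F, hF, ⟨c / 2, by positivity, ?_⟩, ?_⟩⟩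
    all_goals
      have ht' : |t - s| < c / 2 := by simpa [Real.dist_eq] using ht
    · intro x
      have h1 := hb x
      have h2 := ((P t + F) - (P s + F)).le_opNorm x
      have h3 : ‖(P s + F) x‖ ≤ ‖(P t + F) x‖ + ‖((P t + F) - (P s + F)) x‖ := by
        have : (P s + F) x = (P t + F) x - ((P t + F) - (P s + F)) x := by simp [add_comm]; abel
        rw [this]; exact norm_sub_le _ _
      have h4 : ‖(P t + F) - (P s + F)‖ * ‖x‖ ≤ c / 2 * ‖x‖ :=
        mul_le_mul_of_nonneg_right ((hdist s t F).trans ht'.le) (norm_nonneg _)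
      linarith
    · intro hsurj
      apply hs
      refine surj_perturb (A := P t + F) (M := (c / 2)⁻¹) (by positivity) ?_ ?_
      · intro y
        obtain ⟨x, hx⟩ := hsurj y
        refine ⟨x, hx, ?_⟩
        have h1 := hb x
        have h2 := ((P t + F) - (P s + F)).le_opNorm x
        have h3 : ‖(P s + F) x‖ ≤ ‖(P t + F) x‖ + ‖((P t + F) - (P s + F)) x‖ := by
          have : (P s + F) x = (P t + F) x - ((P t + F) - (P s + F)) x := by simp [add_comm]; abel
          rw [this]; exact norm_sub_le _ _
        have h4 : ‖(P t + F) - (P s + F)‖ * ‖x‖ ≤ c / 2 * ‖x‖ :=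
          mul_le_mul_of_nonneg_right ((hdist s t F).trans ht'.le) (norm_nonneg _)
        rw [hx] at h3
        rw [← div_eq_inv_mul, le_div_iff₀ (by positivity)]
        linarith
      · rw [inv_inv]
        refine (hdist t s F).trans_lt ?_
        rwa [abs_sub_comm]
  have hV : IsOpen {s | NonNeg (P s)} := by
    rw [Metric.isOpen_iff]
    rintro s ⟨F, hF, hs⟩
    obtain ⟨M, hM, hM'⟩ := (P s + F).exists_preimage_norm_le hs
    refine ⟨M⁻¹, by positivity, fun t ht => ⟨F, hF, surj_perturb hM hM' ?_⟩⟩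
    refine (hdist s t F).trans_lt ?_
    simpa [Real.dist_eq] using ht
  have h0 : FinRk (0 : E →L[ℝ] E) := by
    unfold FinRk
    have : (0 : E →L[ℝ] E).toLinearMap.range = ⊥ := by
      rw [LinearMap.range_eq_bot]; rfl
    rw [this]; infer_instance
  have hP0 : P 0 = T := by simp [P]
  have hc : Ici (0 : ℝ) ⊆ {s | Neg (P s)} ∪ {s | NonNeg (P s)} := fun s hs => (hPr s hs).neg_or
  have hneg : (Ici (0 : ℝ) ∩ {s | Neg (P s)}).Nonempty := by
    refine ⟨0, self_mem_Ici, 0, h0, ?_, ?_⟩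
    · rw [add_zero]
      exact (hPr 0 le_rfl).bddBelow (by change Function.Injective (P 0); rwa [hP0])
    · rwa [add_zero, hP0]
  have hnn : (Ici (0 : ℝ) ∩ {s | NonNeg (P s)}).Nonempty := by
    refine ⟨‖T‖ + 1, by simp only [mem_Ici]; positivity, 0, h0, ?_⟩
    rw [add_zero]
    have hp : 0 < ‖T‖ + 1 := by positivity
    refine surj_perturb (A := (‖T‖ + 1) • ContinuousLinearMap.id ℝ E) (M := (‖T‖ + 1)⁻¹)
      (by positivity) ?_ ?_
    · intro y
      refine ⟨(‖T‖ + 1)⁻¹ • y, ?_, ?_⟩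
      · simp [smul_smul, inv_mul_cancel₀ hp.ne']
      · rw [norm_smul, norm_inv, Real.norm_of_nonneg hp.le]
    · simp [P]
  obtain ⟨s, -, ⟨F, hF, ⟨c, hc0, hb⟩, hns'⟩, ⟨G, hG, hs⟩⟩ :=
    isPreconnected_Ici _ _ hU hV hc hneg hnn
  apply hns'
  refine not_both hG hF ?_ hs
  rw [injective_iff_map_eq_zero]
  intro x hx
  have := hb x
  rw [hx, norm_zero] at this
  have h2 : ‖x‖ ≤ 0 := by
    by_contra hcon
    push Not at hcon
    have := mul_pos hc0 hcon
    linarith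
  exact norm_le_zero_iff.1 h2

end FA

end CKInj

namespace CKInj

open Filter Topology Set MeasureTheory
open scoped NNReal CompactlySupported

section Dom

variable {K : Type*} [TopologicalSpace K] [CompactSpace K]

/-- values of `φ` on the order interval `[-f, f]` -/
def domSet (φ : C(K, ℝ) →L[ℝ] ℝ) (f : C_c(K, ℝ≥0)) : Set ℝ :=
  {r | ∃ g : C(K, ℝ), (∀ x, |g x| ≤ (f x : ℝ)) ∧ φ g = r}

theorem domSet_zero_mem (φ : C(K, ℝ) →L[ℝ] ℝ) (f : C_c(K, ℝ≥0)) : (0 : ℝ) ∈ domSet φ f :=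
  ⟨0, fun x => by simp, by simp⟩

theorem domSet_le (φ : C(K, ℝ) →L[ℝ] ℝ) (f : C_c(K, ℝ≥0)) (c : ℝ) (hc : 0 ≤ c)
    (hf : ∀ x, (f x : ℝ) ≤ c) : ∀ r ∈ domSet φ f, r ≤ ‖φ‖ * c := by
  rintro r ⟨g, hg, rfl⟩
  refine (le_abs_self _).trans ((φ.le_opNorm g).trans ?_)
  refine mul_le_mul_of_nonneg_left ?_ (norm_nonneg _)
  rw [ContinuousMap.norm_le _ hc]
  exact fun x => (hg x).trans (hf x)

theorem domSet_bdd (φ : C(K, ℝ) →L[ℝ] ℝ) (f : C_c(K, ℝ≥0)) : BddAbove (domSet φ f) := by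
  let F : C(K, ℝ) := ⟨fun x => (f x : ℝ), by fun_prop⟩
  refine ⟨‖φ‖ * ‖F‖, domSet_le φ f _ (norm_nonneg _) fun x => ?_⟩
  exact (le_abs_self _).trans (F.norm_coe_le_norm x)

noncomputable def domVal (φ : C(K, ℝ) →L[ℝ] ℝ) (f : C_c(K, ℝ≥0)) : ℝ := sSup (domSet φ f)

theorem domVal_nonneg (φ : C(K, ℝ) →L[ℝ] ℝ) (f : C_c(K, ℝ≥0)) : 0 ≤ domVal φ f :=
  le_csSup (domSet_bdd φ f) (domSet_zero_mem φ f)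

theorem le_domVal (φ : C(K, ℝ) →L[ℝ] ℝ) (f : C_c(K, ℝ≥0)) (g : C(K, ℝ))
    (hg : ∀ x, |g x| ≤ (f x : ℝ)) : φ g ≤ domVal φ f :=
  le_csSup (domSet_bdd φ f) ⟨g, hg, rfl⟩

theorem domVal_le (φ : C(K, ℝ) →L[ℝ] ℝ) (f : C_c(K, ℝ≥0)) (c : ℝ)
    (h : ∀ g : C(K, ℝ), (∀ x, |g x| ≤ (f x : ℝ)) → φ g ≤ c) : domVal φ f ≤ c :=
  csSup_le ⟨0, domSet_zero_mem φ f⟩ (by rintro r ⟨g, hg, rfl⟩; exact h g hg)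

theorem domVal_add (φ : C(K, ℝ) →L[ℝ] ℝ) (f₁ f₂ : C_c(K, ℝ≥0)) :
    domVal φ (f₁ + f₂) = domVal φ f₁ + domVal φ f₂ := by
  apply le_antisymm
  · refine domVal_le _ _ _ fun g hg => ?_
    let g1 : C(K, ℝ) := ⟨fun x => max (-(f₁ x : ℝ)) (min (g x) (f₁ x)), by fun_prop⟩
    have h1 : ∀ x, |g1 x| ≤ (f₁ x : ℝ) := fun x => by
      have : (0 : ℝ) ≤ f₁ x := (f₁ x).2
      rw [abs_le]
      refine ⟨le_max_left _ _, max_le (by linarith) (min_le_right _ _)⟩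
    have h2 : ∀ x, |(g - g1) x| ≤ (f₂ x : ℝ) := fun x => by
      have a1 : (0 : ℝ) ≤ f₁ x := (f₁ x).2
      have a2 : (0 : ℝ) ≤ f₂ x := (f₂ x).2
      have hgx := hg x
      simp only [CompactlySupportedContinuousMap.coe_add, Pi.add_apply, NNReal.coe_add] at hgx
      rw [abs_le] at hgx
      change |g x - max (-(f₁ x : ℝ)) (min (g x) (f₁ x))| ≤ _
      rcases max_cases (-(f₁ x : ℝ)) (min (g x) (f₁ x)) with ⟨e, e'⟩ | ⟨e, e'⟩ <;>
      rcases min_cases (g x) (f₁ x : ℝ) with ⟨d, d'⟩ | ⟨d, d'⟩ <;>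
      rw [e] <;> rw [abs_le] <;> constructor <;> linarith
    have : φ g = φ g1 + φ (g - g1) := by rw [← map_add]; simp
    rw [this]
    exact add_le_add (le_domVal _ _ _ h1) (le_domVal _ _ _ h2)
  · have : domVal φ f₁ ≤ domVal φ (f₁ + f₂) - domVal φ f₂ := by
      refine domVal_le _ _ _ fun g hg => ?_
      rw [le_sub_iff_add_le, add_comm, ← le_sub_iff_add_le]
      refine domVal_le _ _ _ fun g' hg' => ?_
      rw [le_sub_iff_add_le, ← map_add]
      refine le_domVal _ _ _ fun x => ?_
      refine (abs_add_le _ _).trans ?_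
      have := add_le_add (hg' x) (hg x)
      simp only [CompactlySupportedContinuousMap.coe_add, Pi.add_apply, NNReal.coe_add]
      linarith
    linarith

theorem domVal_smul_le (φ : C(K, ℝ) →L[ℝ] ℝ) (c : ℝ≥0) (f : C_c(K, ℝ≥0)) (hc : c ≠ 0) :
    domVal φ (c • f) ≤ c * domVal φ f := by
  have hc' : 0 < (c : ℝ) := by positivity
  refine domVal_le _ _ _ fun g hg => ?_
  have : φ ((c : ℝ)⁻¹ • g) ≤ domVal φ f := by
    refine le_domVal _ _ _ fun x => ?_
    have := hg x
    simp only [CompactlySupportedContinuousMap.coe_smul, Pi.smul_apply, smul_eq_mul,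
      NNReal.coe_mul] at this
    rw [ContinuousMap.smul_apply, smul_eq_mul, abs_mul, abs_inv, abs_of_pos hc',
      inv_mul_le_iff₀ hc']
    exact this
  rw [map_smul, smul_eq_mul, inv_mul_le_iff₀ hc'] at this
  exact this

theorem domVal_smul (φ : C(K, ℝ) →L[ℝ] ℝ) (c : ℝ≥0) (f : C_c(K, ℝ≥0)) :
    domVal φ (c • f) = c * domVal φ f := by
  by_cases hc : c = 0
  · subst hc
    have : domVal φ ((0 : ℝ≥0) • f) = 0 := by
      apply le_antisymm _ (domVal_nonneg _ _)
      refine domVal_le _ _ _ fun g hg => ?_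
      have : g = 0 := by
        ext x
        have := hg x
        simpa using this
      simp [this]
    rw [this]; simp
  · apply le_antisymm (domVal_smul_le φ c f hc)
    have := domVal_smul_le φ c⁻¹ (c • f) (inv_ne_zero hc)
    rw [smul_smul, inv_mul_cancel₀ hc, one_smul, NNReal.coe_inv] at this
    have hc' : 0 < (c : ℝ) := by positivity
    rwa [le_inv_mul_iff₀ hc'] at this

noncomputable def domLin (φ : C(K, ℝ) →L[ℝ] ℝ) : C_c(K, ℝ≥0) →ₗ[ℝ≥0] ℝ≥0 where
  toFun f := ⟨domVal φ f, domVal_nonneg φ f⟩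
  map_add' f g := by
    apply NNReal.eq
    exact domVal_add φ f g
  map_smul' c f := by
    apply NNReal.eq
    exact domVal_smul φ c f

theorem exists_dom [T2Space K] [MeasurableSpace K] [BorelSpace K] (φ : C(K, ℝ) →L[ℝ] ℝ) :
    ∃ μ : Measure K, IsFiniteMeasure μ ∧ μ.real univ ≤ ‖φ‖ ∧ ∀ f : C(K, ℝ),
      |φ f| ≤ ∫ x, |f x| ∂μ := by
  let μ := NNRealRMK.rieszMeasure (domLin φ)
  have hμ : ∀ f : C_c(K, ℝ≥0), ∫ x, (f x : ℝ) ∂μ = domVal φ f :=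
    fun f => NNRealRMK.integral_rieszMeasure (domLin φ) f
  have hfin : IsFiniteMeasure μ := inferInstance
  refine ⟨μ, hfin, ?_, ?_⟩
  · let f : C_c(K, ℝ≥0) := ⟨⟨fun _ => 1, continuous_const⟩, HasCompactSupport.of_compactSpace _⟩
    have h1 := hμ f
    have h2 : ∫ x, (f x : ℝ) ∂μ = μ.real univ := by
      have : ∀ x, (f x : ℝ) = 1 := fun x => rfl
      simp [this]
    rw [← h2, h1]
    refine domVal_le _ _ _ fun g hg => ?_
    have := domSet_le φ f 1 zero_le_one (fun x => le_rfl) _ ⟨g, hg, rfl⟩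
    simpa using this
  · intro f
    let g : C_c(K, ℝ≥0) := ⟨⟨fun x => ‖f x‖₊, by fun_prop⟩, HasCompactSupport.of_compactSpace _⟩
    have h1 := hμ g
    have h2 : ∫ x, (g x : ℝ) ∂μ = ∫ x, |f x| ∂μ := rfl
    rw [← h2, h1, abs_le]
    constructor
    · have := le_domVal φ g (-f) (fun x => by
        change |-(f x)| ≤ |f x|
        rw [abs_neg])
      rw [map_neg] at this
      linarith
    · exact le_domVal φ g f (fun x => le_rfl)

end Dom

end CKInj

namespace CKInj

open Set Cardinal Filter

structure Idx (I : Type) [LinearOrder I] : Prop where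
  card : #I = 𝔠
  small : ∀ a : I, #(Iio a) < 𝔠
  bdd : ∀ s : Set I, s.Countable → ∃ c, ∀ y ∈ s, y < c

theorem exists_idx : ∃ (I : Type) (_ : LinearOrder I) (_ : WellFoundedLT I), Idx I := by
  refine ⟨(𝔠 : Cardinal.{0}).ord.ToType, inferInstance, inferInstance, ?_, ?_, ?_⟩
  · simp
  · intro a
    exact mk_Iio_toType_ord_lt a
  · intro s hs
    have h1 : ℵ₀ < Order.cof (𝔠 : Cardinal.{0}).ord.ToType := by
      rw [← Ordinal.cof_type, Ordinal.type_toType, ← two_power_aleph0]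
      exact lt_cof_ord_power le_rfl one_lt_two
    have h2 : ¬ IsCofinal s := fun h => by
      have := (Order.cof_le h).trans hs.le_aleph0
      exact absurd (h1.trans_le this) (lt_irrefl _)
    simp only [IsCofinal] at h2
    push Not at h2
    exact h2

theorem exists_rec {I Dt : Type} [LinearOrder I] [WellFoundedLT I] [Inhabited Dt]
    (P : I → (I → Dt) → Prop)
    (hloc : ∀ a D D', (∀ b ≤ a, D b = D' b) → P a D → P a D')
    (hext : ∀ a D, (∀ b < a, P b D) → ∃ d, P a (Function.update D a d)) :
    ∃ D, ∀ a, P a D := by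
  classical
  let step : (a : I) → ((b : I) → b < a → Dt) → Dt := fun a ih =>
    let D0 : I → Dt := fun b => if h : b < a then ih b h else default
    if h : ∃ d, P a (Function.update D0 a d) then h.choose else default
  let D : I → Dt := (wellFounded_lt (α := I)).fix step
  have hD : ∀ a, D a = step a (fun b _ => D b) := fun a => WellFounded.fix_eq _ _ _
  refine ⟨D, fun a => ?_⟩
  induction a using (wellFounded_lt (α := I)).induction with
  | _ a ih =>
    let D0 : I → Dt := fun b => if h : b < a then D b else default
    have h0 : ∀ b < a, P b D0 := fun b hb => by
      refine hloc b D D0 (fun c hc => ?_) (ih b hb)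
      have : c < a := hc.trans_lt hb
      simp [D0, this]
    have hex := hext a D0 h0
    have e : D a = hex.choose := by
      rw [hD]
      exact dif_pos hex
    refine hloc a _ D (fun b hb => ?_) hex.choose_spec
    rcases hb.eq_or_lt with rfl | hb
    · simp [e]
    · simp [hb.ne, D0, hb]

/-! almost disjoint family -/

def AD (f : ℕ → Bool) : Set ℕ := range fun n => Encodable.encode ((List.range n).map f)

theorem AD_inf (f : ℕ → Bool) : (AD f).Infinite := by
  apply infinite_range_of_injective
  intro n m h
  have := congrArg List.length (Encodable.encode_injective h)
  simpa using this

theorem AD_fin {f g : ℕ → Bool} (h : f ≠ g) : (AD f ∩ AD g).Finite := by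
  obtain ⟨m, hm⟩ := Function.ne_iff.1 h
  refine ((Set.finite_Iic m).image
    (fun n => Encodable.encode ((List.range n).map f))).subset ?_
  rintro _ ⟨⟨n, rfl⟩, ⟨n', hn'⟩⟩
  refine ⟨n, ?_, rfl⟩
  have h1 := Encodable.encode_injective hn'
  have h2 : n' = n := by simpa using congrArg List.length h1
  subst h2
  by_contra hcon
  simp only [mem_Iic, not_le] at hcon
  rw [List.map_inj_left] at h1
  exact hm (h1 m (by simpa using hcon)).symm

theorem AD_inj {f g : ℕ → Bool} (h : AD f = AD g) : f = g := by
  by_contra hn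
  have := AD_fin hn
  rw [← h, inter_self] at this
  exact AD_inf f this

/-! cylinder sets -/

def Cyl {S : Type} (T : Set S) : Set (Set (S → Bool)) :=
  {A | ∃ s : Finset S, (↑s : Set S) ⊆ T ∧ ∀ u v : S → Bool, (∀ i ∈ s, u i = v i) → (u ∈ A ↔ v ∈ A)}

section Cyl
variable {S : Type} {T T' : Set S}

theorem Cyl.mono (h : T ⊆ T') : Cyl T ⊆ Cyl T' := fun _ ⟨s, hs, hA⟩ => ⟨s, hs.trans h, hA⟩

theorem Cyl.inter {A B : Set (S → Bool)} (hA : A ∈ Cyl T) (hB : B ∈ Cyl T) : A ∩ B ∈ Cyl T := by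
  classical
  obtain ⟨s, hs, hA⟩ := hA
  obtain ⟨t, ht, hB⟩ := hB
  refine ⟨s ∪ t, by simp [hs, ht], fun u v h => ?_⟩
  have h1 := hA u v (fun i hi => h i (Finset.mem_union_left _ hi))
  have h2 := hB u v (fun i hi => h i (Finset.mem_union_right _ hi))
  exact and_congr h1 h2

theorem Cyl.compl {A : Set (S → Bool)} (hA : A ∈ Cyl T) : Aᶜ ∈ Cyl T := by
  obtain ⟨s, hs, hA⟩ := hA
  exact ⟨s, hs, fun u v h => not_congr (hA u v h)⟩

theorem Cyl.union {A B : Set (S → Bool)} (hA : A ∈ Cyl T) (hB : B ∈ Cyl T) : A ∪ B ∈ Cyl T := by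
  have := Cyl.compl (Cyl.inter (Cyl.compl hA) (Cyl.compl hB))
  rwa [compl_inter, compl_compl, compl_compl] at this

theorem Cyl.empty : (∅ : Set (S → Bool)) ∈ Cyl T := ⟨∅, by simp, fun u v _ => by simp⟩

theorem Cyl.biUnion {ι : Type*} {t : Set ι} (ht : t.Finite) {A : ι → Set (S → Bool)}
    (h : ∀ i ∈ t, A i ∈ Cyl T) : (⋃ i ∈ t, A i) ∈ Cyl T := by
  induction t, ht using Set.Finite.induction_on with
  | empty => simpa using Cyl.empty
  | insert _ _ ih =>
    rw [biUnion_insert]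
    exact Cyl.union (h _ (mem_insert _ _)) (ih fun i hi => h i (mem_insert_of_mem _ hi))

theorem Cyl.coord {i : S} (hi : i ∈ T) (c : Bool) : {u : S → Bool | u i = c} ∈ Cyl T :=
  ⟨{i}, by simpa using hi, fun u v h => by simp [h i (by simp)]⟩

theorem Cyl.isClopen {A : Set (S → Bool)} (hA : A ∈ Cyl T) : IsClopen A := by
  obtain ⟨s, -, hA⟩ := hA
  have key : ∀ B : Set (S → Bool), (∀ u v : S → Bool, (∀ i ∈ s, u i = v i) → (u ∈ B ↔ v ∈ B)) →
      IsOpen B := by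
    intro B hB
    rw [isOpen_pi_iff]
    intro u hu
    refine ⟨s, fun i => {u i}, fun i _ => ⟨isOpen_discrete _, rfl⟩, fun v hv => ?_⟩
    exact (hB u v fun i hi => ((hv i hi : v i = u i)).symm).1 hu
  refine ⟨⟨key _ fun u v h => not_congr (hA u v h)⟩, key A hA⟩

theorem Cyl.card_le : #(Cyl T) ≤ max #T ℵ₀ := by
  classical
  let F : (Σ s : Finset T, Set (s → Bool)) → Cyl T := fun p =>
    ⟨{u | (fun i : p.1 => u i.1.1) ∈ p.2}, p.1.map (Function.Embedding.subtype _),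
      by intro i hi; simp at hi; exact hi.1, fun u v h => by
        have : (fun i : p.1 => u i.1.1) = fun i : p.1 => v i.1.1 := by
          funext i
          exact h _ (by simp)
        simp [this]⟩
  have hF : Function.Surjective F := by
    rintro ⟨A, s, hs, hA⟩
    refine ⟨⟨s.subtype (· ∈ T),
      {w | ∃ u ∈ A, ∀ i : s.subtype (· ∈ T), u i.1.1 = w i}⟩, ?_⟩
    apply Subtype.ext
    ext u
    constructor
    · rintro ⟨v, hv, h⟩
      refine (hA v u fun i hi => ?_).1 hv
      exact h ⟨⟨i, hs hi⟩, by simpa using hi⟩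
    · intro hu
      exact ⟨u, hu, fun i => rfl⟩
  refine (mk_le_of_surjective hF).trans ?_
  rw [mk_sigma]
  have h1 : ∀ s : Finset T, #(Set (s → Bool)) ≤ ℵ₀ := fun s => mk_le_aleph0
  refine (sum_le_sum _ (fun _ => ℵ₀) h1).trans ?_
  rw [sum_const, lift_id, lift_id]
  have h2 : #(Finset T) ≤ max #T ℵ₀ := by
    rcases finite_or_infinite T with h | h
    · exact (mk_le_aleph0).trans (le_max_right _ _)
    · rw [mk_finset_of_infinite]; exact le_max_left _ _
  exact mul_le_of_le (le_max_right _ _) h2 (le_max_right _ _)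

theorem Cyl.update [DecidableEq S] {A : Set (S → Bool)} {i : S} {T' : Set S} (hA : A ∈ Cyl T)
    (hT : T \ {i} ⊆ T') (c : Bool) : {u | Function.update u i c ∈ A} ∈ Cyl T' := by
  obtain ⟨s, hs, hA⟩ := hA
  refine ⟨s.erase i, ?_, fun u v h => ?_⟩
  · intro j hj
    simp at hj
    exact hT ⟨hs hj.1, hj.2⟩
  · refine hA _ _ fun j hj => ?_
    by_cases e : j = i
    · subst e; simp
    · simp [e, h j (Finset.mem_erase.2 ⟨e, hj⟩)]

end Cyl

end CKInj

namespace CKInj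

open Set Cardinal Filter

section Constr
open scoped Classical

variable {I : Type} [LinearOrder I]

abbrev Dt (I : Type) := Set I × Set I × (ℕ → Bool)

abbrev sidx : I ⊕ I → I := Sum.elim id id

noncomputable def vv (D : I → Dt I) (x : I) : I ⊕ I → Bool
  | Sum.inl z => decide (x = z)
  | Sum.inr b => decide (if x < b then x ∈ (D b).2.1 else b ∈ (D x).1)

def Slt (a : I) : Set (I ⊕ I) := {i | sidx i < a}
def Sle (a : I) : Set (I ⊕ I) := {i | sidx i ≤ a}
def Srow (a : I) : Set (I ⊕ I) := insert (Sum.inr a) (Slt a)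

theorem vv_congr {D D' : I → Dt I} {x : I} {i : I ⊕ I} (h1 : D x = D' x)
    (h2 : D (sidx i) = D' (sidx i)) : vv D x i = vv D' x i := by
  cases i with
  | inl z => rfl
  | inr b =>
    simp only [vv]
    simp only [sidx, Sum.elim_inr, id] at h2
    rw [h1, h2]

theorem mem_congr {D D' : I → Dt I} {x : I} {T : Set (I ⊕ I)} {p : Set (I ⊕ I → Bool)}
    (hp : p ∈ Cyl T) (h1 : D x = D' x) (h2 : ∀ i ∈ T, D (sidx i) = D' (sidx i)) :
    vv D x ∈ p ↔ vv D' x ∈ p := by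
  obtain ⟨s, hs, hp⟩ := hp
  exact hp _ _ fun i hi => vv_congr h1 (h2 i (hs hi))

theorem vv_update (D : I → Dt I) (a : I) (d : Dt I) {z : I} (hz : z < a) :
    vv (Function.update D a d) z = Function.update (vv D z) (Sum.inr a) (decide (z ∈ d.2.1)) := by
  funext i
  by_cases hi : i = Sum.inr a
  · subst hi
    simp [vv, hz]
  · rw [Function.update_of_ne hi]
    cases i with
    | inl z => rfl
    | inr b =>
      have hb : b ≠ a := fun h => hi (by rw [h])
      simp [vv, hb, hz.ne]

theorem vv_inl_ne (D : I → Dt I) {a z : I} (hz : z ≠ a) :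
    Function.update (vv D z) (Sum.inl a) false = vv D z := by
  funext i
  by_cases hi : i = Sum.inl a
  · subst hi
    simp [vv, hz]
  · rw [Function.update_of_ne hi]

abbrev Task (I : Type) := (ℕ → Set (I ⊕ I → Bool)) × (ℕ → I)

variable (task : I → Task I)

structure Valid (D : I → Dt I) (a : I) : Prop where
  inf : (Iio a).Infinite
  pts : ∀ k, (task a).2 k < a
  cyl : ∀ n, (task a).1 n ∈ Cyl (Slt a)
  disj : ∀ n m, n ≠ m → ∀ z < a, vv D z ∈ (task a).1 n → vv D z ∉ (task a).1 m
  out : ∀ k n, vv D ((task a).2 k) ∉ (task a).1 n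

structure Good (D : I → Dt I) (a : I) : Prop where
  col : Valid task D a → (∀ z < a, z ∈ (D a).2.1 ↔ ∃ n ∈ AD (D a).2.2, vv D z ∈ (task a).1 n) ∧
    ∀ b < a, Valid task D b → task b = task a → (D b).2.2 ≠ (D a).2.2
  col' : ¬ Valid task D a → (D a).2.1 = ∅
  promise : ∀ b ≤ a, Valid task D b → ∀ p ∈ Cyl (Sle a),
    ¬ ∀ k, vv D ((task b).2 k) ∈ p ↔ k ∈ AD (D b).2.2
  row : ∃ U : Ultrafilter I, (U : Filter I) ≤ cofinite ∧ (∀ᶠ z in (U : Filter I), z < a) ∧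
    (∀ i ∈ Srow a, ∀ᶠ z in (U : Filter I), vv D z i = vv D a i) ∧
    ((∀ n, (task a).1 n ∈ Cyl (Slt a)) →
      (∀ N, {z | z < a ∧ ∀ n ≤ N, vv D z ∈ (task a).1 n}.Infinite) →
      ∀ n, ∀ᶠ z in (U : Filter I), vv D z ∈ (task a).1 n)

variable {task}

theorem Valid.congr {D D' : I → Dt I} {a : I} (h : ∀ b < a, D b = D' b) (hv : Valid task D a) :
    Valid task D' a where
  inf := hv.inf
  pts := hv.pts
  cyl := hv.cyl
  disj := fun n m hnm z hz h1 h2 => by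
    refine hv.disj n m hnm z hz ?_ ?_
    · exact (mem_congr (hv.cyl n) (h z hz) fun i hi => h _ hi).2 h1
    · exact (mem_congr (hv.cyl m) (h z hz) fun i hi => h _ hi).2 h2
  out := fun k n h1 => hv.out k n
    ((mem_congr (hv.cyl n) (h _ (hv.pts k)) fun i hi => h _ hi).2 h1)

theorem valid_iff {D D' : I → Dt I} {a : I} (h : ∀ b < a, D b = D' b) :
    Valid task D a ↔ Valid task D' a :=
  ⟨fun hv => hv.congr h, fun hv => hv.congr fun b hb => (h b hb).symm⟩

theorem Good.congr {D D' : I → Dt I} {a : I} (h : ∀ b ≤ a, D b = D' b) (hg : Good task D a) :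
    Good task D' a where
  col := fun hv => by
    have hv' := (valid_iff fun b hb => h b hb.le).2 hv
    obtain ⟨h1, h2⟩ := hg.col hv'
    rw [← h a le_rfl]
    refine ⟨fun z hz => (h1 z hz).trans ?_, fun b hb hvb => ?_⟩
    · refine exists_congr fun n => and_congr_right fun _ => ?_
      exact mem_congr (hv.cyl n) (h z hz.le) fun i hi => h _ (le_of_lt hi)
    · rw [← h b hb.le]
      exact h2 b hb ((valid_iff fun c hc => h c (hc.le.trans hb.le)).2 hvb)
  col' := fun hv => by
    rw [← h a le_rfl]
    exact hg.col' fun hv' => hv (hv'.congr fun b hb => h b hb.le)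
  promise := fun b hb hvb p hp hcon => by
    have hvb' := (valid_iff fun c hc => h c (hc.le.trans hb)).2 hvb
    refine hg.promise b hb hvb' p hp fun k => ?_
    rw [h b hb, ← hcon k]
    exact mem_congr hp (h _ ((hvb.pts k).le.trans hb)) fun i hi => h _ hi
  row := by
    obtain ⟨U, hU1, hU2, hU3, hU4⟩ := hg.row
    refine ⟨U, hU1, hU2, fun i hi => ?_, fun hc hinf n => ?_⟩
    · have hi' : sidx i ≤ a := by
        rcases hi with rfl | hi
        · exact le_rfl
        · exact le_of_lt hi
      filter_upwards [hU3 i hi, hU2] with z hz hza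
      rw [← vv_congr (h z hza.le) (h _ hi'), hz, vv_congr (h a le_rfl) (h _ hi')]
    · have hm : ∀ n, ∀ z < a, (vv D z ∈ (task a).1 n ↔ vv D' z ∈ (task a).1 n) := fun n z hz =>
        mem_congr (hc n) (h z hz.le) fun i hi => h _ (le_of_lt hi)
      have := hU4 hc (fun N => by
        convert hinf N using 3 with z
        refine and_congr_right fun hz => forall_congr' fun n => forall_congr' fun _ => hm n z hz) n
      filter_upwards [this, hU2] with z hz hza
      exact (hm n z hza).1 hz

theorem exists_stage {a b : I} (hb : b < a) {p : Set (I ⊕ I → Bool)} (hp : p ∈ Cyl (Slt a)) :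
    ∃ c < a, b ≤ c ∧ p ∈ Cyl (Sle c) := by
  obtain ⟨s, hs, hp⟩ := hp
  have hne : (insert b (s.image sidx)).Nonempty := Finset.insert_nonempty _ _
  refine ⟨(insert b (s.image sidx)).max' hne, ?_, Finset.le_max' _ _ (Finset.mem_insert_self _ _),
    s, fun i hi => ?_, hp⟩
  · rw [Finset.max'_lt_iff]
    intro y hy
    rcases Finset.mem_insert.1 hy with rfl | hy
    · exact hb
    · obtain ⟨i, hi, rfl⟩ := Finset.mem_image.1 hy
      exact hs hi
  · exact Finset.le_max' _ _ (Finset.mem_insert_of_mem (Finset.mem_image_of_mem _ hi))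

theorem nosep_old {D : I → Dt I} {a b : I} (hg : ∀ b < a, (Iio b).Infinite → Good task D b)
    (hb : b < a) (hv : Valid task D b) {p : Set (I ⊕ I → Bool)} (hp : p ∈ Cyl (Slt a)) :
    ¬ ∀ k, vv D ((task b).2 k) ∈ p ↔ k ∈ AD (D b).2.2 := by
  obtain ⟨c, hc, hbc, hpc⟩ := exists_stage hb hp
  exact (hg c hc (hv.inf.mono (Iio_subset_Iio hbc))).promise b hbc hv p hpc

theorem card_Slt_lt (hI : Idx I) (a : I) : #(Cyl (Slt a)) < 𝔠 := by
  refine Cyl.card_le.trans_lt (max_lt ?_ aleph0_lt_continuum)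
  let F : Slt a → Iio a ⊕ Iio a := fun i => match i with
    | ⟨Sum.inl z, h⟩ => Sum.inl ⟨z, h⟩
    | ⟨Sum.inr z, h⟩ => Sum.inr ⟨z, h⟩
  have hF : Function.Injective F := by
    rintro ⟨z | z, h⟩ ⟨w | w, h'⟩ e <;> simp [F] at e <;> simpa using congrArg Subtype.val e
  refine (mk_le_of_injective hF).trans_lt ?_
  rw [mk_sum, lift_id]
  exact add_lt_of_lt aleph0_le_continuum (hI.small a) (hI.small a)

theorem exists_col (hI : Idx I) {D : I → Dt I} {a : I}
    (hg : ∀ b < a, (Iio b).Infinite → Good task D b) :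
    ∃ (c : Set I) (f : ℕ → Bool),
      (Valid task D a → (∀ z < a, z ∈ c ↔ ∃ n ∈ AD f, vv D z ∈ (task a).1 n) ∧
        ∀ b < a, Valid task D b → task b = task a → (D b).2.2 ≠ f) ∧
      (¬ Valid task D a → c = ∅) ∧
      (∀ b < a, Valid task D b → ∀ q : Bool → Set (I ⊕ I → Bool), (∀ t, q t ∈ Cyl (Slt a)) →
        ¬ ∀ k, vv D ((task b).2 k) ∈ q (decide ((task b).2 k ∈ c)) ↔ k ∈ AD (D b).2.2) ∧
      (Valid task D a → ∀ q ∈ Cyl (Slt a), ¬ ∀ k, vv D ((task a).2 k) ∈ q ↔ k ∈ AD f) := by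
  by_cases hv : Valid task D a
  swap
  · refine ⟨∅, fun _ => false, fun h => absurd h hv, fun _ => rfl, ?_, fun h => absurd h hv⟩
    intro b hb hvb q hq hcon
    simp only [mem_empty_iff_false, decide_false] at hcon
    exact nosep_old hg hb hvb (hq false) hcon
  let col : (ℕ → Bool) → Set I := fun f => {z | ∃ n ∈ AD f, vv D z ∈ (task a).1 n}
  let W := Iio a ⊕ (Cyl (Slt a) ⊕ (Iio a × (Bool → Cyl (Slt a))))
  have hW : #W < 𝔠 := by
    have h1 := hI.small a
    have h2 := card_Slt_lt hI a
    have h3 : #(Bool → Cyl (Slt a)) < 𝔠 := by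
      have : #(Bool → Cyl (Slt a)) ≤ #(Cyl (Slt a) × Cyl (Slt a)) :=
        mk_le_of_injective (f := fun q => (q true, q false)) (by
          intro q q' e
          funext t
          cases t <;> simp_all)
      refine this.trans_lt ?_
      rw [mk_prod, lift_id]
      exact mul_lt_of_lt aleph0_le_continuum h2 h2
    simp only [W, mk_sum, mk_prod, lift_id]
    exact add_lt_of_lt aleph0_le_continuum h1 (add_lt_of_lt aleph0_le_continuum h2
      (mul_lt_of_lt aleph0_le_continuum h1 h3))
  let Wit : (ℕ → Bool) → W → Prop := fun f w => match w with
    | Sum.inl b => f = (D b).2.2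
    | Sum.inr (Sum.inl q) => ∀ k, vv D ((task a).2 k) ∈ q.1 ↔ k ∈ AD f
    | Sum.inr (Sum.inr (b, q)) => Valid task D b ∧
      ∀ k, vv D ((task b).2 k) ∈ (q (decide ((task b).2 k ∈ col f))).1 ↔ k ∈ AD (D b).2.2
  have hWit : ∀ f f' w, Wit f w → Wit f' w → f = f' := by
    rintro f f' (b | q | ⟨b, q⟩) h h'
    · exact h.trans h'.symm
    · refine AD_inj ?_
      ext k
      exact (h k).symm.trans (h' k)
    · obtain ⟨hvb, h⟩ := h
      obtain ⟨-, h'⟩ := h'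
      by_contra hne
      let r : Set (I ⊕ I → Bool) := ⋃ n ∈ AD f ∩ AD f', (task a).1 n
      have hr : r ∈ Cyl (Slt a) := Cyl.biUnion (AD_fin hne) fun n _ => hv.cyl n
      have hs : (r ∩ (q true).1) ∪ (rᶜ ∩ (q false).1) ∈ Cyl (Slt a) :=
        Cyl.union (Cyl.inter hr (q true).2) (Cyl.inter (Cyl.compl hr) (q false).2)
      refine nosep_old hg b.2 hvb hs fun k => ?_
      set z := (task b).2 k with hz
      have hza : z < a := (hvb.pts k).trans b.2
      have hk := h k
      have hk' := h' k
      rw [← hz] at hk hk'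
      have hcol : vv D z ∈ r ↔ z ∈ col f ∧ z ∈ col f' := by
        constructor
        · intro hzr
          obtain ⟨n, hn, hzn⟩ := mem_iUnion₂.1 hzr
          exact ⟨⟨n, hn.1, hzn⟩, ⟨n, hn.2, hzn⟩⟩
        · rintro ⟨⟨n, hn, hzn⟩, ⟨m, hm, hzm⟩⟩
          have : n = m := by
            by_contra hnm
            exact hv.disj n m hnm z hza hzn hzm
          subst this
          exact mem_iUnion₂.2 ⟨n, ⟨hn, hm⟩, hzn⟩
      by_cases hzr : vv D z ∈ r
      · have h1 := (hcol.1 hzr).1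
        simp only [h1, decide_true] at hk
        rw [← hk]
        simp [hzr]
      · have h1 : z ∉ col f ∨ z ∉ col f' := by
          by_contra hcon
          push Not at hcon
          exact hzr (hcol.2 hcon)
        rcases h1 with h1 | h1
        · simp only [h1, decide_false] at hk
          rw [← hk]
          simp [hzr]
        · simp only [h1, decide_false] at hk'
          rw [← hk']
          simp [hzr]
  have hf : ∃ f, ∀ w, ¬ Wit f w := by
    by_contra hcon
    push Not at hcon
    choose w hw using hcon
    have hinj : Function.Injective w := fun f f' e => hWit f f' (w f) (hw f) (e ▸ hw f')
    have := mk_le_of_injective hinj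
    have h2 : #(ℕ → Bool) = 𝔠 := by simp
    rw [h2] at this
    exact absurd (this.trans_lt hW) (lt_irrefl _)
  obtain ⟨f, hf⟩ := hf
  refine ⟨col f, f, fun _ => ⟨fun z _ => Iff.rfl, fun b hb _ _ e => ?_⟩, fun h => absurd hv h, ?_, ?_⟩
  · exact hf (Sum.inl ⟨b, hb⟩) e.symm
  · intro b hb hvb q hq hcon
    exact hf (Sum.inr (Sum.inr (⟨b, hb⟩, fun t => ⟨q t, hq t⟩))) ⟨hvb, hcon⟩
  · intro _ q hq hcon
    exact hf (Sum.inr (Sum.inl ⟨q, hq⟩)) hcon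

theorem exists_uf (A : ℕ → Set I) (hA : Antitone A) (hinf : ∀ n, (A n).Infinite) :
    ∃ U : Ultrafilter I, (U : Filter I) ≤ cofinite ∧ ∀ n, A n ∈ U := by
  have hne : NeBot (⨅ n, (cofinite ⊓ 𝓟 (A n))) := by
    apply iInf_neBot_of_directed'
    · intro n m
      refine ⟨max n m, ?_, ?_⟩
      · exact inf_le_inf_left _ (principal_mono.2 (hA (le_max_left _ _)))
      · exact inf_le_inf_left _ (principal_mono.2 (hA (le_max_right _ _)))
    · intro n
      rw [cofinite_inf_principal_neBot_iff]
      exact hinf n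
  refine ⟨Ultrafilter.of (⨅ n, (cofinite ⊓ 𝓟 (A n))), (Ultrafilter.of_le _).trans ?_, fun n => ?_⟩
  · exact (iInf_le _ 0).trans inf_le_left
  · have : (⨅ n, (cofinite ⊓ 𝓟 (A n))) ≤ 𝓟 (A n) := (iInf_le _ n).trans inf_le_right
    exact (Ultrafilter.of_le _).trans this (mem_principal_self _)

theorem exists_D [WellFoundedLT I] (hI : Idx I) :
    ∃ D : I → Dt I, ∀ a, (Iio a).Infinite → Good task D a := by
  refine exists_rec (fun a D => (Iio a).Infinite → Good task D a) ?_ ?_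
  · intro a D D' h hP hinf
    exact (hP hinf).congr h
  intro a D hg
  by_cases hinf : (Iio a).Infinite
  swap
  · exact ⟨default, fun h => absurd h hinf⟩
  obtain ⟨c, f, hc1, hc2, hc3, hc4⟩ := exists_col hI hg
  let D1 : I → Dt I := Function.update D a (∅, c, f)
  have hU : ∃ U : Ultrafilter I, (U : Filter I) ≤ cofinite ∧ (∀ᶠ z in (U : Filter I), z < a) ∧
    ((∀ N, {z | z < a ∧ ∀ n ≤ N, vv D1 z ∈ (task a).1 n}.Infinite) →
      ∀ n, ∀ᶠ z in (U : Filter I), vv D1 z ∈ (task a).1 n) := by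
    by_cases h : ∀ N, {z | z < a ∧ ∀ n ≤ N, vv D1 z ∈ (task a).1 n}.Infinite
    · obtain ⟨U, hU1, hU2⟩ := exists_uf (fun N => {z | z < a ∧ ∀ n ≤ N, vv D1 z ∈ (task a).1 n})
        (fun N M hNM z hz => ⟨hz.1, fun n hn => hz.2 n (hn.trans hNM)⟩) h
      refine ⟨U, hU1, ?_, fun _ n => ?_⟩
      · filter_upwards [hU2 0] with z hz using hz.1
      · filter_upwards [hU2 n] with z hz using hz.2 n le_rfl
    · obtain ⟨U, hU1, hU2⟩ := exists_uf (fun _ => Iio a) (fun _ _ _ => le_rfl) (fun _ => hinf)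
      exact ⟨U, hU1, hU2 0, fun h' => absurd h' h⟩
  obtain ⟨U, hU1, hU2, hU3⟩ := hU
  let r : Set I := {b | ∀ᶠ z in (U : Filter I), vv D1 z (Sum.inr b) = true}
  refine ⟨(r, c, f), fun _ => ?_⟩
  set D' := Function.update D a (r, c, f) with hD'
  have hlt : ∀ b < a, D b = D' b := fun b hb => by simp [hD', hb.ne]
  have hDa : D' a = (r, c, f) := by simp [hD']
  have hv1 : ∀ z < a, vv D' z = vv D1 z := fun z hz => by
    rw [vv_update _ _ _ hz, vv_update _ _ _ hz]
  have hval : Valid task D a ↔ Valid task D' a := valid_iff hlt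
  have hvalb : ∀ b ≤ a, (Valid task D b ↔ Valid task D' b) := fun b hb =>
    valid_iff fun c hc => hlt c (hc.trans_le hb)
  have hsub : ∀ p ∈ Cyl (Sle a), ∀ t, {u : I ⊕ I → Bool | Function.update (Function.update u
      (Sum.inl a) false) (Sum.inr a) t ∈ p} ∈ Cyl (Slt a) := by
    intro p hp t
    have h1 := Cyl.update (T' := Sle a \ {Sum.inr a}) (i := Sum.inr a) hp le_rfl t
    refine Cyl.update (T' := Slt a) (i := Sum.inl a) h1 ?_ false
    rintro (z | z) ⟨⟨h1, h2⟩, h3⟩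
    · exact lt_of_le_of_ne h1 (fun e => h3 (by simp only [sidx, Sum.elim_inl, id] at e; simp [e]))
    · exact lt_of_le_of_ne h1 (fun e => h2 (by simp only [sidx, Sum.elim_inr, id] at e; simp [e]))
  refine ⟨?_, ?_, ?_, ?_⟩
  · intro hv
    have hv' := hval.2 hv
    obtain ⟨h1, h2⟩ := hc1 hv'
    rw [hDa]
    refine ⟨fun z hz => (h1 z hz).trans ?_, fun b hb hvb hbt => ?_⟩
    · refine exists_congr fun n => and_congr_right fun _ => ?_
      exact mem_congr (hv.cyl n) (hlt z hz) fun i hi => hlt _ hi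
    · rw [← hlt b hb]
      exact h2 b hb ((hvalb b hb.le).2 hvb) hbt
  · intro hv
    rw [hDa]
    exact hc2 (fun h => hv (hval.1 h))
  · intro b hb hvb p hp hcon
    have hvb' := (hvalb b hb).2 hvb
    have hpt : ∀ z < a, vv D' z = Function.update (Function.update (vv D z)
      (Sum.inl a) false) (Sum.inr a) (decide (z ∈ c)) := fun z hz => by
      rw [vv_update _ _ _ hz, vv_inl_ne _ hz.ne]
    rcases hb.eq_or_lt with rfl | hb
    · refine hc4 hvb' _ (hsub p hp false) fun k => ?_
      have h1 := hcon k
      rw [hDa] at h1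
      rw [← h1, hpt _ (hvb.pts k)]
      have : (task b).2 k ∉ c := fun h => by
        obtain ⟨n, -, hn⟩ := ((hc1 hvb').1 _ (hvb.pts k)).1 h
        exact hvb'.out k n hn
      simp [this]
    · refine hc3 b hb hvb' _ (hsub p hp) fun k => ?_
      have h1 := hcon k
      rw [← hlt b hb] at h1
      rw [← h1, hpt _ ((hvb.pts k).trans hb)]
      rfl
  · refine ⟨U, hU1, hU2, ?_, ?_⟩
    · have hrow : ∀ b ≤ a, ∀ᶠ z in (U : Filter I), vv D' z (Sum.inr b) = vv D' a (Sum.inr b) := by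
        intro b hb
        have h1 : vv D' a (Sum.inr b) = decide (b ∈ r) := by
          simp [vv, hb.not_gt, hDa]
        rw [h1]
        by_cases hbr : b ∈ r
        · have : ∀ᶠ z in (U : Filter I), vv D1 z (Sum.inr b) = true := hbr
          filter_upwards [this, hU2] with z hz hza
          rw [hv1 z hza, hz]; simp [hbr]
        · have : ∀ᶠ z in (U : Filter I), ¬ vv D1 z (Sum.inr b) = true :=
            Ultrafilter.eventually_not.2 hbr
          filter_upwards [this, hU2] with z hz hza
          rw [hv1 z hza]; simp [hbr, hz]
      rintro i (rfl | hi)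
      · exact hrow a le_rfl
      · cases i with
        | inr b => exact hrow b (le_of_lt hi)
        | inl b =>
          have hne : ∀ᶠ z in (U : Filter I), z ≠ b :=
            hU1 (by simp [Filter.mem_cofinite] : {z | z ≠ b} ∈ cofinite)
          filter_upwards [hne] with z hz
          have hba : a ≠ b := fun h => by
            simp only [Slt, sidx, mem_setOf_eq, Sum.elim_inl, id] at hi
            exact absurd hi (by rw [h]; exact lt_irrefl _)
          simp [vv, hz, hba]
    · intro _ hinf' n
      have := hU3 (fun N => by
        convert hinf' N using 3 with z
        refine and_congr_right fun hz => ?_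
        rw [hv1 z hz]) n
      filter_upwards [this, hU2] with z hz hza
      rw [hv1 z hza]; exact hz

end Constr

end CKInj

namespace CKInj

open Set Cardinal Filter

structure Intf {K X : Type} [TopologicalSpace K] (ι : X → K) : Prop where
  inj : Function.Injective ι
  dense : DenseRange ι
  iso : ∀ x, IsOpen {ι x}
  infX : Infinite X
  c1 : ∀ (e : ℕ → Set K), (∀ n, IsClopen (e n)) → Pairwise (Function.onFun Disjoint e) →
    ∀ x : ℕ → X, (∀ n m, ι (x n) ∉ e m) →
    ∃ (J : Type) (_ : Uncountable J) (E : J → Set K) (M : J → Set ℕ),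
      (∀ j, IsClopen (E j)) ∧ (∀ j n, n ∈ M j → e n ⊆ E j) ∧
      (∀ j n, n ∉ M j → Disjoint (e n) (E j)) ∧
      (∀ i j, i ≠ j → ∃ L : ℕ, E i ∩ E j ⊆ ⋃ n < L, e n) ∧
      (∀ j, ¬ ∃ C : Set K, IsClopen C ∧ ∀ k, ι (x k) ∈ C ↔ k ∈ M j)
  c2 : ∀ b : ℕ → Set K, (∀ n, IsClopen (b n)) → Antitone b → (∀ n, (ι ⁻¹' b n).Infinite) →
    ∃ x, ∀ n, ι x ∈ b n

section
open scoped Classical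
variable {I : Type} [LinearOrder I]

theorem exists_task (hI : Idx I) : ∃ task : I → Task I, ∀ t : Task I,
    (∀ n, t.1 n ∈ Cyl univ) → ∀ c, ∃ a > c, task a = t := by
  let TT := (ℕ → (Cyl (univ : Set (I ⊕ I)))) × (ℕ → I)
  have hcyl : #(Cyl (univ : Set (I ⊕ I))) ≤ 𝔠 := by
    refine Cyl.card_le.trans (max_le ?_ aleph0_le_continuum)
    rw [mk_univ, mk_sum, lift_id, hI.card, continuum_add_self]
  have hTT : #TT ≤ 𝔠 := by
    rw [mk_prod, lift_id, lift_id]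
    refine mul_le_of_le aleph0_le_continuum ?_ ?_
    · rw [← power_def, mk_nat, ← continuum_power_aleph0]
      exact power_le_power_right hcyl
    · rw [← power_def, mk_nat, hI.card, continuum_power_aleph0]
  have hne : Nonempty I := by
    rw [← mk_ne_zero_iff, hI.card]
    exact continuum_ne_zero
  have : Nonempty (TT × I) := ⟨((fun _ => ⟨∅, Cyl.empty⟩), fun _ => Classical.arbitrary I),
    Classical.arbitrary I⟩
  have hle : #(TT × I) ≤ #I := by
    rw [mk_prod, lift_id, lift_id, hI.card]
    exact mul_le_of_le aleph0_le_continuum hTT le_rfl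
  obtain ⟨g⟩ := hle
  let t : I → TT × I := Function.invFun g
  have ht : Function.Surjective t := Function.invFun_surjective g.injective
  refine ⟨fun a => (fun n => ((t a).1.1 n).1, (t a).1.2), fun τ hτ c => ?_⟩
  by_contra hcon
  push Not at hcon
  let τ' : TT := (fun n => ⟨τ.1 n, hτ n⟩, τ.2)
  choose s hs using fun i : I => ht (τ', i)
  have hsc : ∀ i, s i ≤ c := fun i => by
    by_contra h
    push Not at h
    refine hcon (s i) h ?_
    rw [hs i]
  have hinj : Function.Injective (fun i => (⟨s i, hsc i⟩ : Iic c)) := by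
    intro i j e
    have e' : s i = s j := congrArg Subtype.val e
    have := hs i
    rw [e', hs j] at this
    exact (Prod.ext_iff.1 this).2.symm
  have h1 := mk_le_of_injective hinj
  have h2 : #(Iic c) < 𝔠 := by
    rw [← Iio_insert]
    refine (mk_insert_le).trans_lt ?_
    exact add_lt_of_lt aleph0_le_continuum (hI.small c) (one_lt_aleph0.trans aleph0_lt_continuum)
  rw [hI.card] at h1
  exact absurd (h1.trans_lt h2) (lt_irrefl _)

variable {task : I → Task I} {D : I → Dt I}

theorem transfer [WellFoundedLT I] (hG : ∀ a, (Iio a).Infinite → Good task D a) {a : I}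
    (ha : (Iio a).Infinite) {p : Set (I ⊕ I → Bool)} (hp : p ∈ Cyl (Srow a))
    (h : ∀ z < a, vv D z ∉ p) : ∀ z, vv D z ∉ p := by
  intro z
  induction z using (wellFounded_lt (α := I)).induction with
  | _ z ih =>
    by_cases hz : z < a
    · exact h z hz
    push Not at hz
    obtain ⟨U, hU1, hU2, hU3, -⟩ := (hG z (ha.mono (Iio_subset_Iio hz))).row
    obtain ⟨s, hs, hp⟩ := hp
    have hsub : Srow a ⊆ Srow z := by
      rintro i (rfl | hi)
      · rcases hz.eq_or_lt with rfl | hz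
        · exact Or.inl rfl
        · exact Or.inr hz
      · exact Or.inr (lt_of_lt_of_le hi hz)
    have hev : ∀ᶠ w in (U : Filter I), ∀ i ∈ s, vv D w i = vv D z i := by
      rw [Filter.eventually_all_finset]
      exact fun i hi => hU3 i (hsub (hs hi))
    obtain ⟨w, hw1, hw2⟩ := (hev.and hU2).exists
    intro hcon
    exact ih w hw2 ((hp _ _ hw1).2 hcon)

theorem exists_bound (hI : Idx I) (p : ℕ → Set (I ⊕ I → Bool)) (hp : ∀ n, p n ∈ Cyl univ)
    (s : Set I) (hs : s.Countable) :
    ∃ c, (Iio c).Infinite ∧ (∀ y ∈ s, y < c) ∧ ∀ n, p n ∈ Cyl (Slt c) := by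
  choose t ht hp using hp
  have : Infinite I := by
    rw [infinite_iff, hI.card]; exact aleph0_le_continuum
  let g := Infinite.natEmbedding I
  obtain ⟨c, hc⟩ := hI.bdd (s ∪ (range g ∪ ⋃ n, sidx '' (t n : Set (I ⊕ I))))
    (hs.union ((countable_range _).union
      (countable_iUnion fun n => ((t n).finite_toSet.image _).countable)))
  refine ⟨c, ?_, fun y hy => hc y (Or.inl hy), fun n => ⟨t n, fun i hi => ?_, hp n⟩⟩
  · refine (infinite_range_of_injective g.injective).mono ?_
    exact fun y hy => hc y (Or.inr (Or.inl hy))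
  · exact hc _ (Or.inr (Or.inr (mem_iUnion.2 ⟨n, mem_image_of_mem _ hi⟩)))

theorem Slt_mono {a b : I} (h : a ≤ b) : Slt a ⊆ Slt b := fun _ hi => lt_of_lt_of_le hi h

theorem clopen_cyl {S : Type} (Y : Set (S → Bool)) (hY : IsClosed Y) (C : Set Y)
    (hC : IsClopen C) : ∃ p ∈ Cyl (univ : Set S), C = Subtype.val ⁻¹' p := by
  have : CompactSpace Y := isCompact_iff_compactSpace.1 hY.isCompact
  obtain ⟨O, hO, hOC⟩ := isOpen_induced_iff.1 hC.isOpen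
  have hcpt : IsCompact C := hC.isClosed.isCompact
  have h1 : ∀ k ∈ C, ∃ s : Finset S, ∀ v : S → Bool, (∀ i ∈ s, v i = k.1 i) → v ∈ O := by
    intro k hk
    rw [← hOC] at hk
    obtain ⟨s, u, hu, hsub⟩ := isOpen_pi_iff.1 hO k.1 hk
    refine ⟨s, fun v hv => hsub fun i hi => ?_⟩
    rw [hv i hi]
    exact (hu i hi).2
  choose! s hs using h1
  let V : Y → Set (S → Bool) := fun k => {v | ∀ i ∈ s k, v i = k.1 i}
  have hV : ∀ k, V k ∈ Cyl (univ : Set S) := fun k => ⟨s k, subset_univ _, fun u v h => by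
    refine forall_congr' fun i => forall_congr' fun hi => ?_
    rw [h i hi]⟩
  obtain ⟨t, ht⟩ := hcpt.elim_nhds_subcover' (fun k _ => Subtype.val ⁻¹' V k) (fun k hk =>
    ((Cyl.isClopen (hV k)).isOpen.preimage continuous_subtype_val).mem_nhds (fun i _ => rfl))
  refine ⟨⋃ k ∈ (t : Set C), V k.1, Cyl.biUnion t.finite_toSet fun k _ => hV _, ?_⟩
  apply Subset.antisymm
  · intro k hk
    obtain ⟨j, hj, hjk⟩ := mem_iUnion₂.1 (ht hk)
    exact mem_iUnion₂.2 ⟨j, hj, hjk⟩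
  · intro k hk
    obtain ⟨j, hj, hjk⟩ := mem_iUnion₂.1 hk
    rw [← hOC]
    exact hs j.1 j.2 k.1 hjk

end

theorem exists_intf : ∃ (K X : Type) (_ : TopologicalSpace K) (_ : CompactSpace K)
    (_ : T2Space K) (_ : TotallyDisconnectedSpace K) (ι : X → K), Intf ι := by
  classical
  obtain ⟨I, _, _, hI⟩ := exists_idx
  obtain ⟨task, htask⟩ := exists_task hI
  obtain ⟨D, hG⟩ := exists_D (task := task) hI
  let Y : Set (I ⊕ I → Bool) := closure (range (vv D))
  have hYc : IsClosed Y := isClosed_closure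
  have hcs : CompactSpace Y := isCompact_iff_compactSpace.1 hYc.isCompact
  let ι : I → Y := fun x => ⟨vv D x, subset_closure ⟨x, rfl⟩⟩
  have hdense : DenseRange ι := by
    intro k
    rw [closure_subtype]
    have : Subtype.val '' range ι = range (vv D) := by
      rw [← range_comp]; rfl
    rw [this]
    exact k.2
  -- a cylinder missing the points misses Y
  have hmiss : ∀ p ∈ Cyl (univ : Set (I ⊕ I)), (∀ z, vv D z ∉ p) → ∀ k ∈ Y, k ∉ p := by
    intro p hp h k hk hkp
    obtain ⟨_, h1, ⟨z, rfl⟩⟩ := mem_closure_iff.1 hk p (Cyl.isClopen hp).isOpen hkp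
    exact h z h1
  refine ⟨Y, I, inferInstance, hcs, inferInstance, inferInstance, ι, ?_, hdense, ?_, ?_, ?_, ?_⟩
  · intro x y e
    have h1 : vv D x = vv D y := congrArg Subtype.val e
    have h2 := congrFun h1 (Sum.inl y)
    simpa [vv] using h2
  · intro x
    have hO : IsOpen {k : Y | k.1 (Sum.inl x) = true} :=
      (Cyl.isClopen (Cyl.coord (mem_univ (Sum.inl x)) true)).isOpen.preimage continuous_subtype_val
    have : {k : Y | k.1 (Sum.inl x) = true} = {ι x} := by
      apply Subset.antisymm
      · intro k hk
        by_contra hne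
        have hO2 : IsOpen ({k : Y | k.1 (Sum.inl x) = true} ∩ {ι x}ᶜ) :=
          hO.inter isClosed_singleton.isOpen_compl
        obtain ⟨z, hz1, hz2⟩ := hdense.exists_mem_open hO2 ⟨k, hk, hne⟩
        have : z = x := by simpa [ι, vv] using hz1
        exact hz2 (by rw [this]; rfl)
      · rintro _ rfl
        simp [ι, vv]
    rw [← this]; exact hO
  · rw [infinite_iff, hI.card]; exact aleph0_le_continuum
  · intro e he hdisj x hx
    choose p hp hep using fun n => clopen_cyl Y hYc (e n) (he n)
    have hmem : ∀ z n, ι z ∈ e n ↔ vv D z ∈ p n := fun z n => by rw [hep n]; rfl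
    obtain ⟨c, hcinf, hcx, hcp⟩ := exists_bound hI p hp (range x) (countable_range x)
    let J := {a : I // c < a ∧ task a = (p, x)}
    have hinf : ∀ j : J, (Iio j.1).Infinite := fun j => hcinf.mono (Iio_subset_Iio j.2.1.le)
    have hcyl : ∀ (j : J) n, p n ∈ Cyl (Slt j.1) := fun j n =>
      Cyl.mono (Slt_mono j.2.1.le) (hcp n)
    have hdis : ∀ n m, n ≠ m → ∀ z, vv D z ∈ p n → vv D z ∉ p m := by
      intro n m hnm z h1 h2
      exact disjoint_left.1 (hdisj hnm) ((hmem z n).2 h1) ((hmem z m).2 h2)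
    have hval : ∀ j : J, Valid task D j.1 := fun j => by
      refine ⟨hinf j, ?_, ?_, ?_, ?_⟩ <;> rw [j.2.2]
      · exact fun k => (hcx _ ⟨k, rfl⟩).trans j.2.1
      · exact hcyl j
      · exact fun n m hnm z _ => hdis n m hnm z
      · exact fun k n h => hx k n ((hmem _ _).2 h)
    have hcol : ∀ j : J, ∀ z < j.1, (vv D z (Sum.inr j.1) = true ↔
        ∃ n ∈ AD (D j.1).2.2, vv D z ∈ p n) := fun j z hz => by
      have := ((hG j.1 (hinf j)).col (hval j)).1 z hz
      rw [j.2.2] at this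
      rw [← this]
      simp [vv, hz]
    have hin : ∀ (j : J) n, n ∈ AD (D j.1).2.2 →
        ∀ k ∈ Y, k ∈ p n → k (Sum.inr j.1) = true := by
      intro j n hn k hk hkn
      by_contra hcon
      have hq : p n ∩ {u | u (Sum.inr j.1) = false} ∈ Cyl (Srow j.1) :=
        Cyl.inter (Cyl.mono (subset_insert _ _) (hcyl j n)) (Cyl.coord (mem_insert _ _) false)
      refine hmiss _ (Cyl.mono (subset_univ _) hq) ?_ k hk ⟨hkn, by simpa using hcon⟩
      refine transfer hG (hinf j) hq fun z hz h => ?_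
      have h1 := (hcol j z hz).2 ⟨n, hn, h.1⟩
      have h2 := h.2
      simp only [mem_setOf_eq] at h2
      simp [h1] at h2
    have hout : ∀ (j : J) n, n ∉ AD (D j.1).2.2 →
        ∀ k ∈ Y, k ∈ p n → k (Sum.inr j.1) = false := by
      intro j n hn k hk hkn
      by_contra hcon
      have hq : p n ∩ {u | u (Sum.inr j.1) = true} ∈ Cyl (Srow j.1) :=
        Cyl.inter (Cyl.mono (subset_insert _ _) (hcyl j n)) (Cyl.coord (mem_insert _ _) true)
      refine hmiss _ (Cyl.mono (subset_univ _) hq) ?_ k hk ⟨hkn, by simpa using hcon⟩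
      refine transfer hG (hinf j) hq fun z hz h => ?_
      obtain ⟨m, hm, hzm⟩ := (hcol j z hz).1 h.2
      have : n ≠ m := fun e => hn (e ▸ hm)
      exact hdis n m this z h.1 hzm
    have hint : ∀ i j : J, i.1 < j.1 → ∃ L : ℕ, ∀ k ∈ Y, k (Sum.inr i.1) = true →
        k (Sum.inr j.1) = true → ∃ n < L, k ∈ p n := by
      intro i j hij
      have hne : (D i.1).2.2 ≠ (D j.1).2.2 :=
        ((hG j.1 (hinf j)).col (hval j)).2 i.1 hij (hval i) (i.2.2.trans j.2.2.symm)
      have hfin := AD_fin hne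
      obtain ⟨L, hL⟩ := hfin.bddAbove
      refine ⟨L + 1, fun k hk hki hkj => ?_⟩
      by_contra hcon
      push Not at hcon
      let r := ⋃ n ∈ AD (D i.1).2.2 ∩ AD (D j.1).2.2, p n
      have hr : r ∈ Cyl (Srow j.1) := Cyl.mono (subset_insert _ _)
        (Cyl.biUnion hfin fun n _ => hcyl j n)
      have hijr : (Sum.inr i.1 : I ⊕ I) ∈ Srow j.1 := Or.inr hij
      have hq : rᶜ ∩ ({u | u (Sum.inr i.1) = true} ∩ {u | u (Sum.inr j.1) = true})
          ∈ Cyl (Srow j.1) :=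
        Cyl.inter (Cyl.compl hr) (Cyl.inter (Cyl.coord hijr true)
          (Cyl.coord (mem_insert _ _) true))
      refine hmiss _ (Cyl.mono (subset_univ _) hq) ?_ k hk ⟨?_, hki, hkj⟩
      · refine transfer hG (hinf j) hq fun z hz ⟨h1, h2, h3⟩ => ?_
        obtain ⟨m, hm, hzm⟩ := (hcol j z hz).1 h3
        apply h1
        refine mem_iUnion₂.2 ⟨m, ⟨?_, hm⟩, hzm⟩
        by_contra hmi
        have := hout i m hmi (vv D z) (ι z).2 hzm
        simp only [mem_setOf_eq] at h2
        rw [h2] at this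
        exact absurd this (by simp)
      · intro hkr
        obtain ⟨n, hn, hkn⟩ := mem_iUnion₂.1 hkr
        exact hcon n (Nat.lt_succ_of_le (hL hn)) hkn
    refine ⟨J, ?_, fun j => {k | k.1 (Sum.inr j.1) = true}, fun j => AD (D j.1).2.2,
      ?_, ?_, ?_, ?_, ?_⟩
    · rw [← not_countable_iff]
      intro hcount
      obtain ⟨d, hd⟩ := hI.bdd (range (Subtype.val : J → I)) (countable_range _)
      obtain ⟨a, ha, hta⟩ := htask (p, x) hp (max c d)
      have := hd a ⟨⟨a, (le_max_left _ _).trans_lt ha, hta⟩, rfl⟩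
      exact absurd (this.trans ((le_max_right c d).trans_lt ha)) (lt_irrefl _)
    · intro j
      exact (Cyl.isClopen (Cyl.coord (mem_univ (Sum.inr j.1)) true)).preimage
        continuous_subtype_val
    · intro j n hn k hk
      rw [hep n] at hk
      exact hin j n hn k.1 k.2 hk
    · intro j n hn
      rw [disjoint_left]
      intro k hk hk2
      rw [hep n] at hk
      have := hout j n hn k.1 k.2 hk
      simp only [mem_setOf_eq] at hk2
      rw [hk2] at this
      exact absurd this (by simp)
    · intro i j hij
      have hne : i.1 ≠ j.1 := fun h => hij (Subtype.ext h)
      rcases lt_or_gt_of_ne hne with h | h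
      · obtain ⟨L, hL⟩ := hint i j h
        refine ⟨L, fun k hk => ?_⟩
        obtain ⟨n, hn, hkn⟩ := hL k.1 k.2 hk.1 hk.2
        refine mem_iUnion₂.2 ⟨n, hn, ?_⟩
        rw [hep n]; exact hkn
      · obtain ⟨L, hL⟩ := hint j i h
        refine ⟨L, fun k hk => ?_⟩
        obtain ⟨n, hn, hkn⟩ := hL k.1 k.2 hk.2 hk.1
        refine mem_iUnion₂.2 ⟨n, hn, ?_⟩
        rw [hep n]; exact hkn
    · rintro j ⟨C, hC, hsep⟩
      obtain ⟨q, ⟨s, -, hq⟩, rfl⟩ := clopen_cyl Y hYc C hC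
      obtain ⟨d, hd⟩ := hI.bdd (insert j.1 (sidx '' (s : Set (I ⊕ I))))
        ((s.finite_toSet.image _).countable.insert _)
      have hjd : j.1 ≤ d := (hd _ (mem_insert _ _)).le
      have := (hG d ((hinf j).mono (Iio_subset_Iio hjd))).promise j.1 hjd (hval j) q
        ⟨s, fun i hi => (hd _ (mem_insert_of_mem _ (mem_image_of_mem _ hi))).le, hq⟩
      rw [j.2.2] at this
      exact this hsep
  · intro b hb hanti hinf
    choose p hp hep using fun n => clopen_cyl Y hYc (b n) (hb n)
    have hmem : ∀ z n, ι z ∈ b n ↔ vv D z ∈ p n := fun z n => by rw [hep n]; rfl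
    let g := fun n => (hinf n).natEmbedding
    obtain ⟨c, hcinf, hcx, hcp⟩ := exists_bound hI p hp (⋃ n, range fun m => (g n m : I))
      (countable_iUnion fun n => countable_range _)
    obtain ⟨a, ha, hta⟩ := htask (p, fun _ => c) hp c
    obtain ⟨U, hU1, hU2, hU3, hU4⟩ := (hG a (hcinf.mono (Iio_subset_Iio ha.le))).row
    rw [hta] at hU4
    have hpa : ∀ n, p n ∈ Cyl (Slt a) := fun n => Cyl.mono (Slt_mono ha.le) (hcp n)
    have hU5 := hU4 hpa (fun N => by
      have h1 : (range fun m => (g N m : I)).Infinite :=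
        infinite_range_of_injective (Subtype.val_injective.comp (g N).injective)
      refine h1.mono ?_
      rintro _ ⟨m, rfl⟩
      refine ⟨(hcx _ (mem_iUnion.2 ⟨N, m, rfl⟩)).trans ha, fun n hn => ?_⟩
      exact (hmem _ _).1 (hanti hn (g N m).2))
    refine ⟨a, fun n => (hmem a n).2 ?_⟩
    obtain ⟨s, hs, hps⟩ := hpa n
    have hev : ∀ᶠ w in (U : Filter I), ∀ i ∈ s, vv D w i = vv D a i := by
      rw [Filter.eventually_all_finset]
      exact fun i hi => hU3 i (Or.inr (hs hi))
    obtain ⟨w, hw1, hw2⟩ := (hev.and (hU5 n)).exists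
    exact (hps _ _ hw1).1 hw2

end CKInj

namespace CKInj

open Filter Topology Set MeasureTheory

theorem rosenthal_aux (s : ℕ → Set ℕ → ℝ) (h0 : ∀ n A, 0 ≤ s n A)
    (hadd : ∀ n A B, Disjoint A B → s n A + s n B ≤ s n (A ∪ B)) {ε : ℝ} (hε : 0 < ε) (j : ℕ) :
    ∀ N : Set ℕ, N.Infinite → (∀ n ∈ N, s n N ≤ j * ε) →
      ∃ M : Set ℕ, M.Infinite ∧ ∀ k ∈ M, s k (M \ {k}) ≤ ε := by
  have hmono : ∀ n A B, A ⊆ B → s n A ≤ s n B := fun n A B hAB => by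
    have := hadd n A (B \ A) disjoint_sdiff_right
    rw [union_diff_cancel hAB] at this
    linarith [h0 n (B \ A)]
  induction j with
  | zero =>
    intro N hN hs
    refine ⟨N, hN, fun k hk => ?_⟩
    have := hs k hk
    simp only [Nat.cast_zero, zero_mul] at this
    linarith [hmono k _ _ (diff_subset : N \ {k} ⊆ N)]
  | succ j ih =>
    intro N hN hs
    let g := hN.natEmbedding
    let P : ℕ → Set ℕ := fun i => range fun m => (g (Nat.pair i m) : ℕ)
    have hPinf : ∀ i, (P i).Infinite := fun i => by
      apply infinite_range_of_injective
      intro m m' h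
      have := g.injective (Subtype.ext h)
      have := congrArg Nat.unpair this
      simpa using this
    have hPN : ∀ i, P i ⊆ N := by
      rintro i _ ⟨m, rfl⟩
      exact (g _).2
    have hPd : ∀ i i' x, x ∈ P i → x ∈ P i' → i = i' := by
      rintro i i' _ ⟨m, rfl⟩ ⟨m', h⟩
      have := g.injective (Subtype.ext h)
      have := congrArg Nat.unpair this
      simp only [Nat.unpair_pair, Prod.mk.injEq] at this
      exact this.1.symm
    by_cases hgood : ∃ i, ∀ k ∈ P i, s k (P i \ {k}) ≤ ε
    · obtain ⟨i, hi⟩ := hgood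
      exact ⟨P i, hPinf i, hi⟩
    push Not at hgood
    choose n hnP hn using hgood
    have hninj : Function.Injective n := fun i i' h => hPd i i' (n i) (hnP i) (h ▸ hnP i')
    refine ih (range n) (infinite_range_of_injective hninj) ?_
    rintro _ ⟨i, rfl⟩
    have hdis : Disjoint (range n) (P i \ {n i}) := by
      rw [disjoint_left]
      rintro _ ⟨i', rfl⟩ ⟨h1, h2⟩
      have := hPd i' i _ (hnP i') h1
      subst this
      exact h2 rfl
    have h1 := hadd (n i) _ _ hdis
    have h2 : s (n i) (range n ∪ P i \ {n i}) ≤ s (n i) N := by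
      apply hmono
      apply union_subset
      · rintro _ ⟨i', rfl⟩
        exact hPN i' (hnP i')
      · exact diff_subset.trans (hPN i)
    have h3 := hs (n i) (hPN i (hnP i))
    have h4 := hn i
    push_cast at h3
    linarith

theorem rosenthal (s : ℕ → Set ℕ → ℝ) (h0 : ∀ n A, 0 ≤ s n A)
    (hadd : ∀ n A B, Disjoint A B → s n A + s n B ≤ s n (A ∪ B)) {B : ℝ}
    (hB : ∀ n, s n univ ≤ B) {ε : ℝ} (hε : 0 < ε) :
    ∃ M : Set ℕ, M.Infinite ∧ ∀ k ∈ M, s k (M \ {k}) ≤ ε := by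
  obtain ⟨j, hj⟩ := exists_nat_ge (B / ε)
  refine rosenthal_aux s h0 hadd hε j univ infinite_univ fun n _ => (hB n).trans ?_
  rwa [div_le_iff₀ hε] at hj

section

variable {K : Type} [TopologicalSpace K]

open scoped Classical in
/-- indicator of a clopen set -/
noncomputable def ind (b : Set K) : C(K, ℝ) :=
  if hb : IsClopen b then ⟨b.indicator 1, (continuous_const (y := (1 : ℝ))).indicator (by
    simp [hb.frontier_eq])⟩ else 0

theorem ind_apply {b : Set K} (hb : IsClopen b) (x : K) : ind b x = b.indicator 1 x := by
  simp [ind, hb]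

theorem ind_mem {b : Set K} (hb : IsClopen b) {x : K} (hx : x ∈ b) : ind b x = 1 := by
  simp [ind_apply hb, hx]

theorem ind_not_mem {b : Set K} (hb : IsClopen b) {x : K} (hx : x ∉ b) : ind b x = 0 := by
  simp [ind_apply hb, hx]

theorem ind_nonneg {b : Set K} (hb : IsClopen b) (x : K) : 0 ≤ ind b x := by
  rw [ind_apply hb]; exact indicator_nonneg (fun _ _ => zero_le_one) _

theorem ind_le_one {b : Set K} (hb : IsClopen b) (x : K) : ind b x ≤ 1 := by
  by_cases h : x ∈ b
  · rw [ind_mem hb h]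
  · rw [ind_not_mem hb h]; exact zero_le_one

theorem ind_add {a b : Set K} (ha : IsClopen a) (hb : IsClopen b) (h : Disjoint a b) :
    ind (a ∪ b) = ind a + ind b := by
  ext x
  rw [ContinuousMap.add_apply, ind_apply ha, ind_apply hb, ind_apply (ha.union hb),
    indicator_union_of_disjoint h]

theorem ind_diff {a b : Set K} (ha : IsClopen a) (hb : IsClopen b) (h : a ⊆ b) :
    ind b = ind a + ind (b \ a) := by
  rw [← ind_add ha (hb.diff ha) disjoint_sdiff_right, union_diff_cancel h]

theorem ind_inter_diff {a b : Set K} (ha : IsClopen a) (hb : IsClopen b) :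
    ind b = ind (b ∩ a) + ind (b \ a) := by
  rw [← ind_add (hb.inter ha) (hb.diff ha) disjoint_inf_sdiff, inter_union_diff]

variable [CompactSpace K]

theorem ind_norm_le {b : Set K} (hb : IsClopen b) : ‖ind b‖ ≤ 1 := by
  rw [ContinuousMap.norm_le _ zero_le_one]
  intro x
  rw [Real.norm_of_nonneg (ind_nonneg hb x)]
  exact ind_le_one hb x

theorem integral_ind [MeasurableSpace K] [BorelSpace K] (μ : Measure K) {b : Set K}
    (hb : IsClopen b) : ∫ x, |ind b x| ∂μ = μ.real b := by
  have : (fun x => |ind b x|) = b.indicator 1 := by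
    funext x
    rw [abs_of_nonneg (ind_nonneg hb x), ind_apply hb]
  rw [this, integral_indicator_one hb.isOpen.measurableSet]

variable [T2Space K] [TotallyDisconnectedSpace K]

theorem clopen_between {C U : Set K} (hC : IsClosed C) (hU : IsOpen U) (h : C ⊆ U) :
    ∃ b, IsClopen b ∧ C ⊆ b ∧ b ⊆ U :=
  exists_clopen_of_closed_subset_open hC hU h

variable {X : Type} {ι : X → K}

theorem Intf.clopen_pt (h : Intf ι) (x : X) : IsClopen {ι x} := ⟨isClosed_singleton, h.iso x⟩

variable [MeasurableSpace K] [BorelSpace K]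

theorem exists_lam (T : C(K, ℝ) →L[ℝ] C(K, ℝ)) (k : K) : ∃ μ : Measure K, IsFiniteMeasure μ ∧
    μ.real univ ≤ ‖T‖ ∧ ∀ b, IsClopen b → |T (ind b) k| ≤ μ.real b := by
  let φ : C(K, ℝ) →L[ℝ] ℝ := (ContinuousMap.evalCLM ℝ k).comp T
  obtain ⟨μ, h1, h2, h3⟩ := exists_dom φ
  refine ⟨μ, h1, h2.trans ?_, fun b hb => ?_⟩
  · refine ContinuousLinearMap.opNorm_le_bound _ T.opNorm_nonneg fun f => ?_
    exact ((T f).norm_coe_le_norm k).trans (T.le_opNorm f)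
  · have := h3 (ind b)
    rwa [integral_ind μ hb] at this

theorem F1_aux (h : Intf ι) (T : C(K, ℝ) →L[ℝ] C(K, ℝ)) (e : ℕ → Set K)
    (he : ∀ n, IsClopen (e n)) (hd : Pairwise (Function.onFun Disjoint e)) (x : ℕ → X)
    (hx : ∀ n, ι (x n) ∉ e n) {ε : ℝ} (hε : 0 < ε)
    (hT : ∀ n, ε ≤ |T (ind (e n)) (ι (x n))|) : False := by
  choose lam hfin hmass hlam using fun n => exists_lam T (ι (x n))
  obtain ⟨μ, hμ⟩ : ∃ μ : ℕ → Measure K, ∀ n, μ n = lam n + Measure.dirac (ι (x n)) :=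
    ⟨_, fun _ => rfl⟩
  have hmeas : ∀ A : Set ℕ, MeasurableSet (⋃ m ∈ A, e m) := fun A =>
    MeasurableSet.biUnion (to_countable A) fun m _ => (he m).isOpen.measurableSet
  have hμfin : ∀ n, IsFiniteMeasure (μ n) := fun n => by
    rw [hμ]; infer_instance
  obtain ⟨M, hMinf, hM⟩ := rosenthal (fun n A => (μ n).real (⋃ m ∈ A, e m))
    (fun n A => measureReal_nonneg) (fun n A B hAB => by
      rw [biUnion_union, measureReal_union _ (hmeas B) (measure_ne_top _ _) (measure_ne_top _ _)]
      rw [disjoint_left]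
      intro k h1 h2
      obtain ⟨i, hi, hki⟩ := mem_iUnion₂.1 h1
      obtain ⟨j, hj, hkj⟩ := mem_iUnion₂.1 h2
      have hij : i ≠ j := fun e => disjoint_left.1 hAB hi (e ▸ hj)
      exact disjoint_left.1 (hd hij) hki hkj) (B := ‖T‖ + 1) (fun n => by
      refine (measureReal_mono (subset_univ _) (measure_ne_top _ _)).trans ?_
      rw [hμ, measureReal_add_apply (measure_ne_top _ _) (measure_ne_top _ _)]
      refine add_le_add (hmass n) ?_
      simp) (ε := min (ε / 3) (1 / 2)) (by positivity)
  have hM1 : ∀ k ∈ M, (lam k).real (⋃ m ∈ M \ {k}, e m) ≤ ε / 3 := fun k hk => by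
    have h1 := hM k hk
    rw [hμ, measureReal_add_apply (measure_ne_top _ _) (measure_ne_top _ _)] at h1
    have h2 : 0 ≤ (Measure.dirac (ι (x k))).real (⋃ m ∈ M \ {k}, e m) := measureReal_nonneg
    have h3 := min_le_left (ε / 3) (1 / 2 : ℝ)
    linarith
  have hM2 : ∀ k ∈ M, ι (x k) ∉ (⋃ m ∈ M \ {k}, e m) := fun k hk hcon => by
    have h1 := hM k hk
    rw [hμ, measureReal_add_apply (measure_ne_top _ _) (measure_ne_top _ _)] at h1
    have h2 : (Measure.dirac (ι (x k))).real (⋃ m ∈ M \ {k}, e m) = 1 := by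
      rw [measureReal_def, Measure.dirac_apply' _ (hmeas _)]
      simp only [indicator_of_mem hcon]
      simp
    have h3 := min_le_right (ε / 3) (1 / 2 : ℝ)
    have h4 : 0 ≤ (lam k).real (⋃ m ∈ M \ {k}, e m) := measureReal_nonneg
    linarith
  let σ : ℕ → ℕ := fun n => ((Set.Infinite.natEmbedding M hMinf) n : ℕ)
  have hσi : Function.Injective σ := Subtype.val_injective.comp (Set.Infinite.natEmbedding M hMinf).injective
  have hσM : ∀ n, σ n ∈ M := fun n => ((Set.Infinite.natEmbedding M hMinf) n).2
  have hoff : ∀ k, (⋃ n ∈ {n | n ≠ k}, e (σ n)) ⊆ ⋃ m ∈ M \ {σ k}, e m := by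
    intro k y hy
    obtain ⟨n, hn, hyn⟩ := mem_iUnion₂.1 hy
    exact mem_iUnion₂.2 ⟨σ n, ⟨hσM n, fun e => hn (hσi e)⟩, hyn⟩
  obtain ⟨J, hJ, E, Mj, hE1, hE2, hE3, hE4, hE5⟩ := h.c1 (fun n => e (σ n)) (fun n => he _)
    (fun n m hnm => hd fun e => hnm (hσi e)) (fun n => x (σ n)) (by
      intro n m hcon
      by_cases hnm : m = n
      · subst hnm
        exact hx _ hcon
      · exact hM2 (σ n) (hσM n) (hoff n (mem_iUnion₂.2 ⟨m, hnm, hcon⟩)))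
  let Bd : J → Set K := fun j => E j \ ⋃ n, e (σ n)
  have hBm : ∀ j, MeasurableSet (Bd j) := fun j => (hE1 j).isOpen.measurableSet.diff
    (MeasurableSet.iUnion fun n => (he _).isOpen.measurableSet)
  have hBd : Pairwise (Function.onFun Disjoint Bd) := by
    intro i j hij
    rw [Function.onFun, disjoint_left]
    rintro y ⟨h1, h2⟩ ⟨h3, -⟩
    obtain ⟨L, hL⟩ := hE4 i j hij
    obtain ⟨n, -, hyn⟩ := mem_iUnion₂.1 (hL ⟨h1, h3⟩)
    exact h2 (mem_iUnion.2 ⟨n, hyn⟩)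
  have hcount : (⋃ k, {j | 0 < lam (σ k) (Bd j)}).Countable :=
    countable_iUnion fun k => Measure.countable_meas_pos_of_disjoint_iUnion hBm hBd
  obtain ⟨j, hj⟩ : ∃ j, j ∉ ⋃ k, {j | 0 < lam (σ k) (Bd j)} := by
    by_contra hcon
    push Not at hcon
    have : (univ : Set J).Countable := hcount.mono fun j _ => hcon j
    exact (not_countable_iff.2 hJ) (countable_univ_iff.1 this)
  have hj0 : ∀ k, (lam (σ k)).real (Bd j) = 0 := fun k => by
    have : ¬ 0 < lam (σ k) (Bd j) := fun h => hj (mem_iUnion.2 ⟨k, h⟩)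
    rw [measureReal_def, le_zero_iff.1 (not_lt.1 this)]; rfl
  have hsmall : ∀ k c, IsClopen c → c ⊆ E j → Disjoint c (e (σ k)) →
      |T (ind c) (ι (x (σ k)))| ≤ ε / 3 := by
    intro k c hc hcE hcd
    refine (hlam (σ k) c hc).trans ?_
    have hsub : c ⊆ Bd j ∪ ⋃ m ∈ M \ {σ k}, e m := by
      intro y hy
      by_cases hyu : y ∈ ⋃ n, e (σ n)
      · right
        obtain ⟨n, hn⟩ := mem_iUnion.1 hyu
        apply hoff k
        refine mem_iUnion₂.2 ⟨n, ?_, hn⟩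
        rintro rfl
        exact disjoint_left.1 hcd hy hn
      · left; exact ⟨hcE hy, hyu⟩
    have h1 := measureReal_mono (μ := lam (σ k)) hsub (measure_ne_top _ _)
    have h2 := measureReal_union_le (μ := lam (σ k)) (Bd j) (⋃ m ∈ M \ {σ k}, e m)
    have h3 := hM1 (σ k) (hσM k)
    rw [hj0 k] at h2
    linarith
  have hout : ∀ k, k ∉ Mj j → |T (ind (E j)) (ι (x (σ k)))| ≤ ε / 3 := fun k hk =>
    hsmall k _ (hE1 j) le_rfl (hE3 j k hk).symm
  have hin : ∀ k, k ∈ Mj j → 2 * ε / 3 ≤ |T (ind (E j)) (ι (x (σ k)))| := fun k hk => by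
    have h1 := hsmall k (E j \ e (σ k)) ((hE1 j).diff (he _)) diff_subset disjoint_sdiff_left
    have h2 := hT (σ k)
    have h3 : T (ind (E j)) (ι (x (σ k))) = T (ind (e (σ k))) (ι (x (σ k))) +
        T (ind (E j \ e (σ k))) (ι (x (σ k))) := by
      rw [ind_diff (he _) (hE1 j) (hE2 j k hk), map_add]; rfl
    rw [h3]
    have h4 := abs_sub_abs_le_abs_sub (T (ind (e (σ k))) (ι (x (σ k))))
      (-T (ind (E j \ e (σ k))) (ι (x (σ k))))
    rw [abs_neg, sub_neg_eq_add] at h4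
    linarith
  obtain ⟨C, hC, hC1, hC2⟩ := clopen_between (C := {y | 2 * ε / 3 ≤ |T (ind (E j)) y|})
    (U := {y | ε / 3 < |T (ind (E j)) y|})
    (isClosed_le continuous_const (T (ind (E j))).continuous.abs)
    (isOpen_lt continuous_const (T (ind (E j))).continuous.abs)
    (fun y (hy : 2 * ε / 3 ≤ _) => by
      change ε / 3 < _
      linarith)
  refine hE5 j ⟨C, hC, fun k => ⟨fun hk => ?_, fun hk => hC1 (hin k hk)⟩⟩
  by_contra hkM
  have h1 : ε / 3 < |T (ind (E j)) (ι (x (σ k)))| := hC2 hk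
  exact absurd (hout k hkM) (not_le.2 h1)

theorem F1 (h : Intf ι) (T : C(K, ℝ) →L[ℝ] C(K, ℝ)) (e : ℕ → Set K)
    (he : ∀ n, IsClopen (e n)) (hd : Pairwise (Function.onFun Disjoint e)) (x : ℕ → X)
    (hx : ∀ n, ι (x n) ∉ e n) {ε : ℝ} (hε : 0 < ε) : ∃ n, |T (ind (e n)) (ι (x n))| < ε := by
  by_contra hcon
  push Not at hcon
  exact F1_aux h T e he hd x hx hε hcon

end

end CKInj

namespace CKInj

open Filter Topology Set MeasureTheory

section

variable {K : Type} [TopologicalSpace K] [CompactSpace K] [T2Space K] [TotallyDisconnectedSpace K]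
  {X : Type} {ι : X → K} [MeasurableSpace K] [BorelSpace K]

/-- diagonal of an operator -/
noncomputable def gd (ι : X → K) (T : C(K, ℝ) →L[ℝ] C(K, ℝ)) (x : X) : ℝ := T (ind {ι x}) (ι x)

theorem Ex (h : Intf ι) (T : C(K, ℝ) →L[ℝ] C(K, ℝ)) (b : ℕ → Set K)
    (hb : ∀ n, IsClopen (b n)) (hd : Pairwise (Function.onFun Disjoint b)) (x : ℕ → X)
    {ε : ℝ} (hε : 0 < ε) : ∃ n, |T (ind (b n \ {ι (x n)})) (ι (x n))| < ε :=
  F1 h T (fun n => b n \ {ι (x n)}) (fun n => (hb n).diff (h.clopen_pt _))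
    (fun _ _ hnm => (hd hnm).mono diff_subset diff_subset) x (fun _ hn => hn.2 rfl) hε

theorem offdiag_finite (h : Intf ι) (T : C(K, ℝ) →L[ℝ] C(K, ℝ)) {ε : ℝ} (hε : 0 < ε) :
    {y | ∃ x, x ≠ y ∧ ε < |T (ind {ι y}) (ι x)|}.Finite := by
  by_contra hinf
  let y := Set.Infinite.natEmbedding _ hinf
  choose x hx1 hx2 using fun n => (y n).2
  obtain ⟨n, hn⟩ := F1 h T (fun n => {ι (y n : X)}) (fun n => h.clopen_pt _)
    (fun n m hnm => by
      simp only [Function.onFun, disjoint_singleton]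
      exact fun e => hnm (y.injective (Subtype.ext (h.inj e)))) x
    (fun n e => hx1 n (h.inj e)) hε
  exact absurd hn (not_lt.2 (hx2 n).le)

theorem offdiag_countable (h : Intf ι) (T : C(K, ℝ) →L[ℝ] C(K, ℝ)) :
    {y | ∃ x, x ≠ y ∧ T (ind {ι y}) (ι x) ≠ 0}.Countable := by
  refine (countable_iUnion fun n : ℕ => (offdiag_finite h T
    (ε := 1 / ((n : ℝ) + 1)) (by positivity)).countable).mono ?_
  rintro y ⟨x, hx, hne⟩
  obtain ⟨n, hn⟩ := exists_nat_one_div_lt (abs_pos.2 hne)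
  exact mem_iUnion.2 ⟨n, x, hx, hn⟩

theorem norm_le_of_dense (h : Intf ι) (f : C(K, ℝ)) {c : ℝ} (hc : 0 ≤ c)
    (hf : ∀ x, |f (ι x)| ≤ c) : ‖f‖ ≤ c := by
  rw [ContinuousMap.norm_le _ hc]
  intro p
  exact h.dense.induction_on (p := fun q => ‖f q‖ ≤ c) p
    (isClosed_le f.continuous.norm continuous_const) hf

def Small (ι : X → K) (T : C(K, ℝ) →L[ℝ] C(K, ℝ)) (ε : ℝ) (a : Set K) : Prop :=
  ∀ b, IsClopen b → b ⊆ a → ∀ x, ι x ∉ b → |T (ind b) (ι x)| ≤ ε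

theorem exists_small (h : Intf ι) (T : C(K, ℝ) →L[ℝ] C(K, ℝ)) {ε : ℝ} (hε : 0 < ε)
    (a : ℕ → Set K) (hd : Pairwise (Function.onFun Disjoint a)) : ∃ n, Small ι T ε (a n) := by
  by_contra hcon
  simp only [Small] at hcon
  push Not at hcon
  choose b hb hba x hx hT using hcon
  obtain ⟨n, hn⟩ := F1 h T b hb (fun n m hnm => (hd hnm).mono (hba n) (hba m)) x hx hε
  exact absurd hn (not_lt.2 (hT n).le)

theorem refine_small (h : Intf ι) (T : C(K, ℝ) →L[ℝ] C(K, ℝ)) {ε : ℝ} (hε : 0 < ε)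
    {a : Set K} (ha : IsClopen a) {Z : Set X} (hZ : Z.Infinite) (hZa : ∀ z ∈ Z, ι z ∈ a) :
    ∃ a', IsClopen a' ∧ a' ⊆ a ∧ (Z ∩ ι ⁻¹' a').Infinite ∧ Small ι T ε a' := by
  let z := Set.Infinite.natEmbedding _ hZ
  have hzi : ∀ n m, ι (z n : X) = ι (z m : X) → n = m := fun n m e =>
    z.injective (Subtype.ext (h.inj e))
  obtain ⟨J, hJ, E, M, hE1, hE2, hE3, hE4, hE5⟩ := h.c1 (fun n => {ι (z (2 * n) : X)})
    (fun n => h.clopen_pt _) (fun n m hnm => by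
      simp only [Function.onFun, disjoint_singleton]
      intro e
      have := hzi _ _ e
      omega) (fun n => (z (2 * n + 1) : X)) (fun n m e => by
      have := hzi _ _ e
      omega)
  have hM : ∀ j, (M j).Infinite := by
    intro j hfin
    refine hE5 j ⟨⋃ k ∈ M j, {ι (z (2 * k + 1) : X)}, hfin.isClopen_biUnion
      fun k _ => h.clopen_pt _, fun k => ?_⟩
    constructor
    · intro hk
      obtain ⟨i, hi, hki⟩ := mem_iUnion₂.1 hk
      have := hzi _ _ hki
      have : k = i := by omega
      exact this ▸ hi
    · intro hk
      exact mem_iUnion₂.2 ⟨k, hk, rfl⟩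
  let j := Infinite.natEmbedding J
  let F : ℕ → Set K := fun n => (a ∩ E (j n)) \ ⋃ i ∈ Iio n, E (j i)
  have hF : ∀ n, IsClopen (F n) := fun n => (ha.inter (hE1 _)).diff
    ((finite_Iio n).isClopen_biUnion fun i _ => hE1 _)
  have hFd : Pairwise (Function.onFun Disjoint F) := by
    have key : ∀ n m, n < m → Disjoint (F n) (F m) := by
      intro n m hnm
      rw [disjoint_left]
      rintro p ⟨⟨-, h1⟩, -⟩ ⟨-, h2⟩
      exact h2 (mem_iUnion₂.2 ⟨n, hnm, h1⟩)
    intro n m hnm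
    rcases lt_or_gt_of_ne hnm with h1 | h1
    · exact key _ _ h1
    · exact (key _ _ h1).symm
  obtain ⟨n, hn⟩ := exists_small h T hε F hFd
  refine ⟨F n, hF n, fun p hp => hp.1.1, ?_, hn⟩
  have hbad : (M (j n) ∩ {k | ∃ i ∈ Iio n, ι (z (2 * k) : X) ∈ E (j i)}).Finite := by
    have : ∀ i ∈ Iio n, {k | k ∈ M (j n) ∧ ι (z (2 * k) : X) ∈ E (j i)}.Finite := by
      intro i hi
      obtain ⟨L, hL⟩ := hE4 (j n) (j i) (fun e => (ne_of_gt hi) (j.injective e))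
      refine (finite_Iio L).subset ?_
      rintro k ⟨hk1, hk2⟩
      have := hL ⟨hE2 _ _ hk1 rfl, hk2⟩
      obtain ⟨m, hm, hkm⟩ := mem_iUnion₂.1 this
      have := hzi _ _ hkm
      have : k = m := by omega
      exact this ▸ hm
    refine ((finite_Iio n).biUnion this).subset ?_
    rintro k ⟨hk, i, hi, hki⟩
    exact mem_iUnion₂.2 ⟨i, hi, hk, hki⟩
  have hinf := (hM (j n)).diff hbad
  have hinf2 := hinf.image (f := fun k => (z (2 * k) : X)) (fun k _ k' _ e => by
    have := hzi _ _ (congrArg ι e)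
    omega)
  refine hinf2.mono ?_
  rintro _ ⟨k, ⟨hk1, hk2⟩, rfl⟩
  refine ⟨(z _).2, ⟨hZa _ (z _).2, hE2 _ _ hk1 rfl⟩, fun hcon => hk2 ⟨hk1, ?_⟩⟩
  obtain ⟨i, hi, hki⟩ := mem_iUnion₂.1 hcon
  exact ⟨i, hi, hki⟩

theorem refine_g (h : Intf ι) (T : C(K, ℝ) →L[ℝ] C(K, ℝ)) {ε : ℝ} (hε : 0 < ε)
    {a : Set K} (ha : IsClopen a) {Z : Set X} (hZ : Z.Infinite) (hZa : ∀ z ∈ Z, ι z ∈ a)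
    (hZg : ∀ δ > 0, {z ∈ Z | δ ≤ |gd ι T z|}.Finite) :
    ∃ a', IsClopen a' ∧ a' ⊆ a ∧ (Z ∩ ι ⁻¹' a').Infinite ∧ ∀ x, ι x ∈ a' → |gd ι T x| ≤ 4 * ε := by
  obtain ⟨a', ha', haa, hinf, hs⟩ := refine_small h T hε ha hZ hZa
  have key : ∀ x, ι x ∈ a' → |T (ind a') (ι x) - gd ι T x| ≤ ε := by
    intro x hx
    have h1 := hs (a' \ {ι x}) (ha'.diff (h.clopen_pt x)) diff_subset x (fun hc => hc.2 rfl)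
    have h2 : T (ind a') (ι x) - gd ι T x = T (ind (a' \ {ι x})) (ι x) := by
      rw [ind_diff (h.clopen_pt x) ha' (singleton_subset_iff.2 hx), map_add, gd]
      simp
    rwa [h2]
  obtain ⟨c, hc, hc1, hc2⟩ := clopen_between (C := {y | |T (ind a') y| ≤ 2 * ε})
    (U := {y | |T (ind a') y| < 3 * ε})
    (isClosed_le (T (ind a')).continuous.abs continuous_const)
    (isOpen_lt (T (ind a')).continuous.abs continuous_const)
    (fun y (hy : _ ≤ 2 * ε) => by
      change _ < 3 * ε
      linarith)
  refine ⟨a' ∩ c, ha'.inter hc, inter_subset_left.trans haa, ?_, ?_⟩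
  · refine (hinf.diff (hZg ε hε)).mono ?_
    rintro z ⟨⟨hz1, hz2⟩, hz3⟩
    refine ⟨hz1, hz2, hc1 ?_⟩
    have h1 : ¬ ε ≤ |gd ι T z| := fun hcon => hz3 ⟨hz1, hcon⟩
    have h2 := key z hz2
    change |T (ind a') (ι z)| ≤ 2 * ε
    rw [abs_le] at h2 ⊢
    rw [not_le, abs_lt] at h1
    constructor <;> linarith [h1.1, h1.2, h2.1, h2.2]
  · rintro x ⟨hx1, hx2⟩
    have h1 : |T (ind a') (ι x)| < 3 * ε := hc2 hx2
    have h2 := key x hx1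
    rw [abs_le] at h2 ⊢
    rw [abs_lt] at h1
    constructor <;> linarith [h1.1, h1.2, h2.1, h2.2]

theorem lemma1 (h : Intf ι) (T : C(K, ℝ) →L[ℝ] C(K, ℝ)) (hT : Function.Injective T) :
    ∃ δ > 0, {x | |gd ι T x| < δ}.Finite := by
  by_contra hcon
  push Not at hcon
  have hX := h.infX
  obtain ⟨f, hf1, hf2⟩ := exists_seq_of_forall_finset_exists
    (fun p : X × ℕ => |gd ι T p.1| < 1 / ((p.2 : ℝ) + 1))
    (fun p q => p.1 ≠ q.1 ∧ p.2 < q.2) (by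
      classical
      intro s _
      obtain ⟨x, hx1, hx2⟩ := (hcon (1 / (((s.sup Prod.snd + 1 : ℕ) : ℝ) + 1))
        (by positivity)).exists_notMem_finset (s.image Prod.fst)
      refine ⟨(x, s.sup Prod.snd + 1), hx1, fun q hq => ⟨?_, ?_⟩⟩
      · rintro rfl
        exact hx2 (Finset.mem_image_of_mem _ hq)
      · exact Nat.lt_succ_of_le (Finset.le_sup (f := Prod.snd) hq))
  have hmono : StrictMono fun n => (f n).2 := strictMono_nat_of_lt_succ fun n =>
    (hf2 n (n + 1) (Nat.lt_succ_self n)).2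
  have hfi : Function.Injective fun n => (f n).1 := by
    intro n m e
    by_contra hnm
    rcases lt_or_gt_of_ne hnm with h1 | h1
    · exact (hf2 _ _ h1).1 e
    · exact (hf2 _ _ h1).1 e.symm
  let Z : Set X := range fun n => (f n).1
  have hZ : Z.Infinite := infinite_range_of_injective hfi
  have hZg : ∀ δ > 0, {z ∈ Z | δ ≤ |gd ι T z|}.Finite := by
    intro δ hδ
    obtain ⟨n, hn⟩ := exists_nat_one_div_lt hδ
    refine ((finite_Iio n).image fun n => (f n).1).subset ?_
    rintro _ ⟨⟨m, rfl⟩, hm⟩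
    refine ⟨m, ?_, rfl⟩
    by_contra hmn
    have h1 : n ≤ m := not_lt.1 hmn
    have h2 := h1.trans (hmono.le_apply (x := m))
    have h3 := hf1 m
    have h4 : 1 / (((f m).2 : ℝ) + 1) ≤ 1 / ((n : ℝ) + 1) := by
      apply one_div_le_one_div_of_le (by positivity)
      have : (n : ℝ) ≤ ((f m).2 : ℝ) := by exact_mod_cast h2
      linarith
    simp only at hm
    linarith
  let S := {a : Set K // IsClopen a ∧ (Z ∩ ι ⁻¹' a).Infinite}
  have step : ∀ (m : ℕ) (a : S), ∃ a' : S, a'.1 ⊆ a.1 ∧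
      ∀ x, ι x ∈ a'.1 → |gd ι T x| ≤ 1 / ((m : ℝ) + 1) := by
    rintro m ⟨a, ha, hinf⟩
    obtain ⟨a', h1, h2, h3, h4⟩ := refine_g h T (ε := 1 / ((m : ℝ) + 1) / 4) (by positivity) ha hinf
      (fun z hz => hz.2) (fun δ hδ => (hZg δ hδ).subset fun z hz => ⟨hz.1.1, hz.2⟩)
    refine ⟨⟨a', h1, h3.mono fun z hz => ⟨hz.1.1, hz.2⟩⟩, h2, fun x hx => ?_⟩
    have := h4 x hx
    linarith
  choose nx hnx1 hnx2 using step
  let A : ℕ → S := fun n => Nat.rec ⟨univ, isClopen_univ, by simpa using hZ⟩ (fun m a => nx m a) n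
  have hA : Antitone fun n => (A n).1 := antitone_nat_of_succ_le fun n => hnx1 n (A n)
  have hAg : ∀ n x, ι x ∈ (A (n + 1)).1 → |gd ι T x| ≤ 1 / ((n : ℝ) + 1) :=
    fun n x hx => hnx2 n (A n) x hx
  obtain ⟨c, hc⟩ := countable_iff_exists_subset_range.1 (offdiag_countable h T)
  obtain ⟨x, hx⟩ := h.c2 (fun n => (A n).1 \ ⋃ i ∈ Iio n, {ι (c i)})
    (fun n => (A n).2.1.diff ((finite_Iio n).isClopen_biUnion fun i _ => h.clopen_pt _))
    (fun n m hnm => diff_subset_diff (hA hnm)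
      (biUnion_subset_biUnion_left fun i (hi : i < n) => lt_of_lt_of_le hi hnm))
    (fun n => by
      have h1 : (ι ⁻¹' (A n).1).Infinite := (A n).2.2.mono inter_subset_right
      refine (h1.diff ((finite_Iio n).image c)).mono ?_
      rintro y ⟨hy1, hy2⟩
      refine ⟨hy1, fun hcon => hy2 ?_⟩
      obtain ⟨i, hi, hyi⟩ := mem_iUnion₂.1 hcon
      exact ⟨i, hi, (h.inj hyi).symm⟩)
  have hxC : x ∉ {y | ∃ x, x ≠ y ∧ T (ind {ι y}) (ι x) ≠ 0} := by
    intro hxc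
    obtain ⟨i, hi⟩ := hc hxc
    exact (hx (i + 1)).2 (mem_iUnion₂.2 ⟨i, Nat.lt_succ_self i, by rw [hi]; rfl⟩)
  have hg0 : gd ι T x = 0 := by
    by_contra hne
    obtain ⟨n, hn⟩ := exists_nat_one_div_lt (abs_pos.2 hne)
    have := hAg n x (hx (n + 1)).1
    linarith
  have h0 : T (ind {ι x}) = 0 := by
    rw [← norm_le_zero_iff]
    refine norm_le_of_dense h _ le_rfl fun y => ?_
    by_cases hyx : y = x
    · subst hyx
      change |gd ι T y| ≤ 0
      rw [hg0, abs_zero]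
    · by_contra hne
      exact hxC ⟨y, hyx, fun e => hne (by rw [e, abs_zero])⟩
  have h1 : ind {ι x} = 0 := hT (h0.trans (map_zero T).symm)
  have h2 := ind_mem (h.clopen_pt x) (x := ι x) rfl
  rw [h1] at h2
  simp at h2

theorem lemma1_sq (h : Intf ι) (T : C(K, ℝ) →L[ℝ] C(K, ℝ)) (hT : Function.Injective T) :
    ∃ δ > 0, {x | gd ι (T.comp T) x < δ}.Finite := by
  obtain ⟨δ, hδ, hfin⟩ := lemma1 h (T.comp T) (hT.comp hT)
  refine ⟨δ, hδ, ?_⟩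
  refine (hfin.union (offdiag_finite h T (ε := δ / 2 / (‖T‖ + 1)) (by positivity))).subset ?_
  intro y hy
  by_contra hcon
  simp only [mem_union, not_or, mem_setOf_eq, not_exists, not_and, not_lt] at hcon hy
  obtain ⟨h1, h2⟩ := hcon
  set r : C(K, ℝ) := T (ind {ι y}) - gd ι T y • ind {ι y} with hr
  have hry : ‖r‖ ≤ δ / 2 / (‖T‖ + 1) := by
    refine norm_le_of_dense h _ (by positivity) fun x => ?_
    by_cases hxy : x = y
    · subst hxy
      simp only [hr, ContinuousMap.sub_apply, ContinuousMap.smul_apply]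
      rw [ind_mem (h.clopen_pt x) (x := ι x) rfl, gd]
      simp only [smul_eq_mul, mul_one, sub_self, abs_zero]
      positivity
    · simp only [hr, ContinuousMap.sub_apply, ContinuousMap.smul_apply]
      rw [ind_not_mem (h.clopen_pt y) (x := ι x) (fun e => hxy (h.inj e))]
      simpa using h2 x hxy
  have h3 : gd ι (T.comp T) y = gd ι T y ^ 2 + T r (ι y) := by
    simp only [hr, map_sub, map_smul, ContinuousMap.sub_apply, ContinuousMap.smul_apply]
    simp only [gd, ContinuousLinearMap.comp_apply, smul_eq_mul]
    ring
  have h4 : |T r (ι y)| ≤ δ / 2 := by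
    refine ((T r).norm_coe_le_norm _).trans ((T.le_opNorm r).trans ?_)
    calc ‖T‖ * ‖r‖ ≤ (‖T‖ + 1) * (δ / 2 / (‖T‖ + 1)) := by
          apply mul_le_mul _ hry (norm_nonneg _) (by positivity)
          linarith
      _ = δ / 2 := by field_simp
  rw [abs_le] at h4
  rcases le_abs.1 h1 with h5 | h5
  · linarith
  · nlinarith [sq_nonneg (gd ι T y)]

end

end CKInj

namespace CKInj

open Filter Topology Set MeasureTheory

section

variable {K : Type} [TopologicalSpace K] [CompactSpace K] {X : Type} {ι : X → K}

/-- the off-diagonal functional -/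
noncomputable def ph (ι : X → K) (T : C(K, ℝ) →L[ℝ] C(K, ℝ)) (x : X) : C(K, ℝ) →L[ℝ] ℝ :=
  (ContinuousMap.evalCLM ℝ (ι x)).comp T - gd ι T x • ContinuousMap.evalCLM ℝ (ι x)

theorem ph_apply (T : C(K, ℝ) →L[ℝ] C(K, ℝ)) (x : X) (f : C(K, ℝ)) :
    ph ι T x f = T f (ι x) - gd ι T x * f (ι x) := rfl

variable [T2Space K] [TotallyDisconnectedSpace K]

theorem ph_ind (h : Intf ι) (T : C(K, ℝ) →L[ℝ] C(K, ℝ)) (x : X) {b : Set K} (hb : IsClopen b) :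
    ph ι T x (ind b) = T (ind (b \ {ι x})) (ι x) := by
  rw [ph_apply]
  by_cases hx : ι x ∈ b
  · rw [ind_mem hb hx, gd, ind_diff (h.clopen_pt x) hb (singleton_subset_iff.2 hx), map_add]
    simp
  · rw [ind_not_mem hb hx, diff_singleton_eq_self hx]
    simp

theorem gd_le (h : Intf ι) (T : C(K, ℝ) →L[ℝ] C(K, ℝ)) (x : X) : |gd ι T x| ≤ ‖T‖ := by
  refine ((T (ind {ι x})).norm_coe_le_norm _).trans ((T.le_opNorm _).trans ?_)
  have := mul_le_mul_of_nonneg_left (ind_norm_le (h.clopen_pt x)) (norm_nonneg T)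
  linarith

theorem ph_le (h : Intf ι) (T : C(K, ℝ) →L[ℝ] C(K, ℝ)) (x : X) (f : C(K, ℝ)) :
    |ph ι T x f| ≤ 2 * ‖T‖ * ‖f‖ := by
  rw [ph_apply]
  have h1 : |T f (ι x)| ≤ ‖T‖ * ‖f‖ := ((T f).norm_coe_le_norm _).trans (T.le_opNorm _)
  have h2 : |gd ι T x * f (ι x)| ≤ ‖T‖ * ‖f‖ := by
    rw [abs_mul]
    exact mul_le_mul (gd_le h T x) (f.norm_coe_le_norm _) (abs_nonneg _) T.opNorm_nonneg
  have h3 := abs_sub (T f (ι x)) (gd ι T x * f (ι x))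
  linarith

variable [MeasurableSpace K] [BorelSpace K]

theorem Ex' (h : Intf ι) (T : C(K, ℝ) →L[ℝ] C(K, ℝ)) (b : ℕ → Set K)
    (hb : ∀ n, IsClopen (b n)) (hd : Pairwise (Function.onFun Disjoint b)) (x : ℕ → X)
    {ε : ℝ} (hε : 0 < ε) : ∃ n, |ph ι T (x n) (ind (b n))| < ε := by
  obtain ⟨n, hn⟩ := Ex h T b hb hd x hε
  exact ⟨n, by rwa [ph_ind h T _ (hb n)]⟩

theorem disj_of_antitone {A c : ℕ → Set K} (hA : Antitone A) (hc : ∀ r, c r ⊆ A r \ A (r + 1)) :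
    Pairwise (Function.onFun Disjoint c) := by
  have key : ∀ n m, n < m → Disjoint (c n) (c m) := by
    intro n m hnm
    rw [disjoint_left]
    intro p h1 h2
    exact (hc n h1).2 (hA hnm (hc m h2).1)
  intro n m hnm
  rcases lt_or_gt_of_ne hnm with h1 | h1
  · exact key _ _ h1
  · exact (key _ _ h1).symm

theorem stab (h : Intf ι) (T : C(K, ℝ) →L[ℝ] C(K, ℝ)) (U : ℕ → Set K) (hU : Monotone U)
    {κ : ℝ} (hκ : 0 < κ) :
    ∃ N, ∀ k c, IsClopen c → c ⊆ U k \ U N → ∀ x, |ph ι T x (ind c)| ≤ κ := by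
  by_contra hcon
  push Not at hcon
  choose k c hc hcU x hx using hcon
  let N : ℕ → ℕ := fun r => Nat.rec 0 (fun _ n => max (k n) n) r
  have hN : ∀ r, N (r + 1) = max (k (N r)) (N r) := fun r => rfl
  have hNm : Monotone N := monotone_nat_of_le_succ fun r => by rw [hN]; exact le_max_right _ _
  obtain ⟨n, hn⟩ := Ex' h T (fun r => c (N r)) (fun r => hc _)
    (disj_of_antitone (A := fun r => (U (N r))ᶜ)
      (fun r s hrs => compl_subset_compl.2 (hU (hNm hrs))) (fun r p hp => by
        have := hcU _ hp
        refine ⟨this.2, fun hcon => hcon (hU ?_ this.1)⟩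
        rw [hN]; exact le_max_left _ _)) (fun r => x (N r)) hκ
  exact absurd hn (not_lt.2 (hx _).le)

theorem exists_lamph (h : Intf ι) (T : C(K, ℝ) →L[ℝ] C(K, ℝ)) : ∃ lam : X → Measure K,
    (∀ x, IsFiniteMeasure (lam x)) ∧ (∀ x, (lam x).real univ ≤ 2 * ‖T‖) ∧
    ∀ x b, IsClopen b → |ph ι T x (ind b)| ≤ (lam x).real b := by
  choose lam h1 h2 h3 using fun x => exists_dom (ph ι T x)
  refine ⟨lam, h1, fun x => (h2 x).trans ?_, fun x b hb => ?_⟩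
  · exact ContinuousLinearMap.opNorm_le_bound _ (by positivity) (ph_le h T x)
  · have := h3 x (ind b)
    rwa [integral_ind _ hb] at this

theorem starstar (h : Intf ι) (T : C(K, ℝ) →L[ℝ] C(K, ℝ)) (lam : X → Measure K)
    (hfin : ∀ x, IsFiniteMeasure (lam x))
    (hlam : ∀ x b, IsClopen b → |ph ι T x (ind b)| ≤ (lam x).real b) {ε : ℝ} (hε : 0 < ε) :
    ∃ (G : Finset X) (η : ℝ), 0 < η ∧ ∀ b, IsClopen b → (∀ y ∈ G, (lam y).real b ≤ η) →
      ∀ x, |ph ι T x (ind b)| ≤ ε := by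
  by_contra hcon
  push Not at hcon
  obtain ⟨f, hf1, hf2⟩ := exists_seq_of_forall_finset_exists
    (fun p : Set K × X × ℕ => IsClopen p.1 ∧ ε < |ph ι T p.2.1 (ind p.1)|)
    (fun p q => p.2.2 < q.2.2 ∧ (lam p.2.1).real q.1 ≤ (1 / 2 : ℝ) ^ q.2.2) (by
      classical
      intro s _
      let n := s.sup (fun p => p.2.2) + 1
      obtain ⟨b, hb, hbG, x, hx⟩ := hcon (s.image fun p => p.2.1) ((1 / 2 : ℝ) ^ n) (by positivity)
      refine ⟨(b, x, n), ⟨hb, hx⟩, fun q hq => ⟨?_, ?_⟩⟩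
      · exact Nat.lt_succ_of_le (Finset.le_sup (f := fun p : Set K × X × ℕ => p.2.2) hq)
      · exact hbG _ (Finset.mem_image_of_mem _ hq))
  have hmono : StrictMono fun n => (f n).2.2 := strictMono_nat_of_lt_succ fun n =>
    (hf2 n (n + 1) (Nat.lt_succ_self n)).1
  let b : ℕ → Set K := fun n => (f n).1
  let x : ℕ → X := fun n => (f n).2.1
  have hb : ∀ n, IsClopen (b n) := fun n => (hf1 n).1
  have hbx : ∀ n, ε < |ph ι T (x n) (ind (b n))| := fun n => (hf1 n).2
  have hbl : ∀ i n, i < n → (lam (x i)).real (b n) ≤ (1 / 2 : ℝ) ^ n := fun i n hin =>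
    (hf2 i n hin).2.trans (pow_le_pow_of_le_one (by norm_num) (by norm_num)
      (hmono.le_apply (x := n)))
  let U : ℕ → ℕ → Set K := fun n k => ⋃ j ∈ Icc n k, b j
  have hUc : ∀ n k, IsClopen (U n k) := fun n k =>
    (finite_Icc n k).isClopen_biUnion fun j _ => hb j
  have hUm : ∀ n, Monotone (U n) := fun n k k' hk =>
    biUnion_subset_biUnion_left fun j hj => ⟨hj.1, hj.2.trans hk⟩
  choose N hN using fun n => stab h T (U n) (hUm n) (κ := ε / 2 ^ (n + 2)) (by positivity)
  let D : ℕ → Set K := fun n => U n (N n)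
  have hDc : ∀ n, IsClopen (D n) := fun n => hUc _ _
  let G : ℕ → Set K := fun n => ⋂ i ∈ Iic n, D i
  have hGc : ∀ n, IsClopen (G n) := fun n => (finite_Iic n).isClopen_biInter fun i _ => hDc i
  have hGm : Antitone G := fun n m hnm =>
    biInter_subset_biInter_left fun j (hj : j ≤ n) => hj.trans hnm
  have hGs : ∀ n, G (n + 1) = G n ∩ D (n + 1) := by
    intro n
    ext p
    simp only [G, mem_iInter, mem_Iic, mem_inter_iff]
    constructor
    · intro hp
      exact ⟨fun i hi => hp i (by omega), hp _ le_rfl⟩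
    · rintro ⟨h1, h2⟩ i hi
      rcases Nat.lt_or_ge n i with h3 | h3
      · have : i = n + 1 := by omega
        exact this ▸ h2
      · exact h1 i h3
  have hdrop : ∀ n i c, i ≤ n → IsClopen c → c ⊆ b n →
      |ph ι T (x n) (ind c)| - ε / 2 ^ (i + 2) ≤ |ph ι T (x n) (ind (c ∩ D i))| := by
    intro n i c hin hc hcb
    have h1 := hN i n (c \ D i) (hc.diff (hDc i))
      (diff_subset_diff_left (fun p hp => mem_iUnion₂.2 ⟨n, ⟨hin, le_rfl⟩, hcb hp⟩)) (x n)
    rw [ind_inter_diff (hDc i) hc, map_add]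
    have h2 := abs_add_le (ph ι T (x n) (ind (c ∩ D i))) (ph ι T (x n) (ind (c \ D i)))
    linarith
  have hbG : ∀ n i, i ≤ n →
      ε * (1 / 2 + 1 / 2 ^ (i + 2)) ≤ |ph ι T (x n) (ind (b n ∩ G i))| := by
    intro n i
    induction i with
    | zero =>
      intro hi
      have h1 := hdrop n 0 (b n) hi (hb n) le_rfl
      have h2 : G 0 = D 0 := by
        ext p; simp [G]
      rw [h2]
      have h3 := hbx n
      norm_num at h1 ⊢
      linarith
    | succ i ih =>
      intro hi
      have h1 := hdrop n (i + 1) (b n ∩ G i) hi ((hb n).inter (hGc i)) inter_subset_left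
      have h2 := ih (by omega)
      rw [hGs, ← inter_assoc]
      have h3 : ε * (1 / 2 + 1 / 2 ^ (i + 2)) - ε / 2 ^ (i + 1 + 2) =
        ε * (1 / 2 + 1 / 2 ^ (i + 1 + 2)) := by
        rw [pow_succ (2 : ℝ) (i + 1 + 1), show i + 1 + 1 = i + 2 from rfl]
        field_simp
        ring
      linarith
  have hlG : ∀ i k, i < k → (lam (x i)).real (G k) ≤ 2 * (1 / 2 : ℝ) ^ k := by
    intro i k hik
    have h1 : (lam (x i)).real (G k) ≤ (lam (x i)).real (D k) :=
      measureReal_mono (biInter_subset_of_mem (mem_Iic.2 le_rfl)) (measure_ne_top _ _)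
    have h2 : ∀ m, (lam (x i)).real (U k m) ≤ 2 * (1 / 2 : ℝ) ^ k - (1 / 2 : ℝ) ^ (max k m) := by
      intro m
      induction m with
      | zero =>
        rcases Nat.eq_zero_or_pos k with h0 | h0
        · omega
        · have : U k 0 = ∅ := by
            simp only [U]
            rw [Icc_eq_empty (by omega)]
            simp
          rw [this, max_eq_left (by omega)]
          simp only [measureReal_empty]
          have : (0 : ℝ) < (1 / 2) ^ k := by positivity
          linarith
      | succ m ih =>
        rcases Nat.lt_or_ge m k with h0 | h0
        · rcases Nat.lt_or_ge (m + 1) k with h00 | h00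
          · have : U k (m + 1) = ∅ := by
              simp only [U]
              rw [Icc_eq_empty (by omega)]
              simp
            rw [this, max_eq_left (by omega)]
            simp only [measureReal_empty]
            have : (0 : ℝ) < (1 / 2) ^ k := by positivity
            linarith
          · have hk : m + 1 = k := by omega
            rw [hk]
            have : U k k = b k := by
              simp only [U, Icc_self, mem_singleton_iff, iUnion_iUnion_eq_left]
            rw [this, max_self]
            have := hbl i k hik
            linarith
        · have h3 : U k (m + 1) ⊆ U k m ∪ b (m + 1) := by
            intro p hp
            obtain ⟨j, hj, hpj⟩ := mem_iUnion₂.1 hp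
            rcases Nat.lt_or_ge m j with h4 | h4
            · right
              have : j = m + 1 := by have := hj.2; omega
              exact this ▸ hpj
            · left; exact mem_iUnion₂.2 ⟨j, ⟨hj.1, h4⟩, hpj⟩
          have h4 := measureReal_mono (μ := lam (x i)) h3 (measure_ne_top _ _)
          have h5 := measureReal_union_le (μ := lam (x i)) (U k m) (b (m + 1))
          have h6 := hbl i (m + 1) (by omega)
          rw [max_eq_right h0] at ih
          rw [max_eq_right (by omega)]
          have h7 : (1 / 2 : ℝ) ^ m = 2 * (1 / 2 : ℝ) ^ (m + 1) := by
            rw [pow_succ]; ring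
          linarith
    have h3 := h2 (N k)
    have : (0 : ℝ) < (1 / 2) ^ (max k (N k)) := by positivity
    linarith
  have hk : ∀ i, ∃ k, i < k ∧ (lam (x i)).real (G k) ≤ ε / 4 := by
    intro i
    obtain ⟨m, hm⟩ := exists_pow_lt_of_lt_one (show 0 < ε / 8 by positivity)
      (show (1 / 2 : ℝ) < 1 by norm_num)
    refine ⟨max m (i + 1), by omega, (hlG i _ (by omega)).trans ?_⟩
    have := pow_le_pow_of_le_one (show (0 : ℝ) ≤ 1 / 2 by norm_num) (by norm_num)
      (le_max_left m (i + 1))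
    linarith
  choose k hk1 hk2 using hk
  let I : ℕ → ℕ := fun r => Nat.rec 0 (fun _ n => k n) r
  have hI : ∀ r, I (r + 1) = k (I r) := fun r => rfl
  have hIm : Monotone I := monotone_nat_of_le_succ fun r => by rw [hI]; exact (hk1 _).le
  obtain ⟨n, hn⟩ := Ex' h T (fun r => (b (I r) ∩ G (I r)) \ G (I (r + 1)))
    (fun r => ((hb _).inter (hGc _)).diff (hGc _))
    (disj_of_antitone (A := fun r => G (I r)) (fun r s hrs => hGm (hIm hrs))
      (fun r => diff_subset_diff_left inter_subset_right)) (fun r => x (I r))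
    (show 0 < ε / 4 by positivity)
  have h1 := hbG (I n) (I n) le_rfl
  rw [ind_inter_diff (hGc (I (n + 1))) ((hb _).inter (hGc _)), map_add] at h1
  have h2 := abs_add_le (ph ι T (x (I n)) (ind (b (I n) ∩ G (I n) ∩ G (I (n + 1)))))
    (ph ι T (x (I n)) (ind ((b (I n) ∩ G (I n)) \ G (I (n + 1)))))
  have h3 := hlam (x (I n)) (b (I n) ∩ G (I n) ∩ G (I (n + 1)))
    (((hb _).inter (hGc _)).inter (hGc _))
  have h4 : (lam (x (I n))).real (b (I n) ∩ G (I n) ∩ G (I (n + 1))) ≤ ε / 4 :=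
    (measureReal_mono inter_subset_right (measure_ne_top _ _)).trans (hk2 (I n))
  have h5 : 0 < ε * (1 / 2 ^ (I n + 2)) := by positivity
  have h6 : ε * (1 / 2 + 1 / 2 ^ (I n + 2)) = ε / 2 + ε * (1 / 2 ^ (I n + 2)) := by ring
  linarith

theorem exists_ctrl (h : Intf ι) (T : C(K, ℝ) →L[ℝ] C(K, ℝ)) :
    ∃ L : Measure K, IsFiniteMeasure L ∧ ∀ ε > 0, ∃ η > 0, ∀ b, IsClopen b → L.real b ≤ η →
      ∀ x, |ph ι T x (ind b)| ≤ ε := by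
  obtain ⟨lam, hfin, hmass, hlam⟩ := exists_lamph h T
  have hX := h.infX
  choose G η hη hG using fun n : ℕ => starstar h T lam hfin hlam
    (ε := 1 / ((n : ℝ) + 1)) (by positivity)
  obtain ⟨c, hc⟩ := countable_iff_exists_subset_range.1
    (countable_iUnion fun n => (G n).finite_toSet.countable)
  let L : Measure K := Measure.sum fun i => ((2 : ENNReal)⁻¹ ^ i) • lam (c i)
  have hLfin : IsFiniteMeasure L := by
    refine ⟨?_⟩
    rw [Measure.sum_apply _ MeasurableSet.univ]
    have : ∀ i, (((2 : ENNReal)⁻¹ ^ i) • lam (c i)) univ ≤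
        (2 : ENNReal)⁻¹ ^ i * ENNReal.ofReal (2 * ‖T‖) := by
      intro i
      rw [Measure.smul_apply, smul_eq_mul]
      gcongr
      rw [← ofReal_measureReal (measure_ne_top _ _)]
      exact ENNReal.ofReal_le_ofReal (hmass _)
    refine (ENNReal.tsum_le_tsum this).trans_lt ?_
    rw [ENNReal.tsum_mul_right, ENNReal.tsum_geometric_two]
    exact ENNReal.mul_lt_top ENNReal.ofNat_lt_top ENNReal.ofReal_lt_top
  have hLle : ∀ i b, IsClopen b → (1 / 2 : ℝ) ^ i * (lam (c i)).real b ≤ L.real b := by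
    intro i b hb
    have h1 : (((2 : ENNReal)⁻¹ ^ i) • lam (c i)) b ≤ L b :=
      Measure.le_sum (fun i => ((2 : ENNReal)⁻¹ ^ i) • lam (c i)) i b
    have h2 := ENNReal.toReal_mono (measure_ne_top _ _) h1
    rw [Measure.smul_apply, smul_eq_mul, ENNReal.toReal_mul] at h2
    simpa [measureReal_def] using h2
  refine ⟨L, hLfin, fun ε hε => ?_⟩
  obtain ⟨n, hn⟩ := exists_nat_one_div_lt hε
  have hidx : ∀ y : X, ∃ i, y ∈ G n → c i = y := by
    intro y
    by_cases hy : y ∈ G n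
    · obtain ⟨i, hi⟩ := hc (mem_iUnion.2 ⟨n, hy⟩)
      exact ⟨i, fun _ => hi⟩
    · exact ⟨0, fun h => absurd h hy⟩
  choose ix hix using hidx
  refine ⟨(1 / 2 : ℝ) ^ ((G n).sup ix) * η n, mul_pos (by positivity) (hη n),
    fun b hb hbL x => (hG n b hb (fun y hy => ?_) x).trans hn.le⟩
  have h1 := hLle (ix y) b hb
  rw [hix y hy] at h1
  have h2 : (1 / 2 : ℝ) ^ ((G n).sup ix) ≤ (1 / 2 : ℝ) ^ (ix y) :=
    pow_le_pow_of_le_one (by norm_num) (by norm_num) (Finset.le_sup hy)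
  have h3 : (1 / 2 : ℝ) ^ (ix y) * (lam y).real b ≤ (1 / 2 : ℝ) ^ (ix y) * η n :=
    h1.trans (hbL.trans (mul_le_mul_of_nonneg_right h2 (hη n).le))
  exact le_of_mul_le_mul_left h3 (by positivity)

end

end CKInj

namespace CKInj

open Filter Topology Set MeasureTheory

section

variable {K : Type} [TopologicalSpace K] [CompactSpace K] [T2Space K] [TotallyDisconnectedSpace K]
  {X : Type} {ι : X → K}

theorem small_pos_aux (φ : C(K, ℝ) →L[ℝ] ℝ) {b : Set K} (hb : IsClopen b) {κ : ℝ}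
    (hκ : ∀ c, IsClopen c → c ⊆ b → |φ (ind c)| ≤ κ) (n : ℕ) :
    ∀ f : C(K, ℝ), (∀ p, 0 ≤ f p) → (∀ p, f p ≤ ind b p) → |φ f| ≤ κ + (2 / 3) ^ n * ‖φ‖ := by
  have hκ0 : 0 ≤ κ := (abs_nonneg _).trans (hκ ∅ isClopen_empty (empty_subset _))
  induction n with
  | zero =>
    intro f h0 h1
    have : ‖f‖ ≤ 1 := by
      rw [ContinuousMap.norm_le _ zero_le_one]
      intro p
      rw [Real.norm_of_nonneg (h0 p)]
      exact (h1 p).trans (ind_le_one hb p)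
    have h2 := φ.le_opNorm f
    have h3 : ‖φ‖ * ‖f‖ ≤ ‖φ‖ * 1 := mul_le_mul_of_nonneg_left this φ.opNorm_nonneg
    rw [Real.norm_eq_abs] at h2
    simp only [pow_zero, one_mul]
    linarith
  | succ n ih =>
    intro f h0 h1
    obtain ⟨c, hc, hc1, hc2⟩ := clopen_between (C := {y | 2 / 3 ≤ f y})
      (U := {y | 1 / 3 < f y})
      (isClosed_le continuous_const f.continuous)
      (isOpen_lt continuous_const f.continuous)
      (fun y (hy : 2 / 3 ≤ f y) => by
        change 1 / 3 < f y
        linarith)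
    have hcb : c ⊆ b := by
      intro p hp
      by_contra hpb
      have h2 : 1 / 3 < f p := hc2 hp
      have h3 := h1 p
      rw [ind_not_mem hb hpb] at h3
      linarith
    let f' : C(K, ℝ) := (3 / 2 : ℝ) • (f - (1 / 3 : ℝ) • ind c)
    have hf' : ∀ p, f' p = 3 / 2 * (f p - 1 / 3 * ind c p) := fun p => rfl
    have h2 := ih f' (fun p => by
      rw [hf']
      by_cases hp : p ∈ c
      · rw [ind_mem hc hp]
        have : 1 / 3 < f p := hc2 hp
        linarith
      · rw [ind_not_mem hc hp]
        linarith [h0 p]) (fun p => by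
      rw [hf']
      by_cases hp : p ∈ c
      · rw [ind_mem hc hp, ind_mem hb (hcb hp)]
        have := (h1 p).trans (ind_le_one hb p)
        linarith
      · rw [ind_not_mem hc hp]
        by_cases hpb : p ∈ b
        · rw [ind_mem hb hpb]
          have : ¬ 2 / 3 ≤ f p := fun h => hp (hc1 h)
          linarith
        · have := h1 p
          rw [ind_not_mem hb hpb] at this ⊢
          linarith)
    have h3 : φ f = 1 / 3 * φ (ind c) + 2 / 3 * φ f' := by
      have : f = (1 / 3 : ℝ) • ind c + (2 / 3 : ℝ) • f' := by
        ext p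
        simp only [ContinuousMap.add_apply, ContinuousMap.smul_apply, smul_eq_mul, hf']
        ring
      conv_lhs => rw [this]
      simp only [map_add, map_smul, smul_eq_mul]
    have h4 := hκ c hc hcb
    have h5 := abs_add_le (1 / 3 * φ (ind c)) (2 / 3 * φ f')
    rw [abs_mul, abs_mul, abs_of_pos (by norm_num : (0 : ℝ) < 1 / 3),
      abs_of_pos (by norm_num : (0 : ℝ) < 2 / 3)] at h5
    rw [h3, pow_succ]
    nlinarith

theorem small_pos (φ : C(K, ℝ) →L[ℝ] ℝ) {b : Set K} (hb : IsClopen b) {κ : ℝ}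
    (hκ : ∀ c, IsClopen c → c ⊆ b → |φ (ind c)| ≤ κ)
    (f : C(K, ℝ)) (h0 : ∀ p, 0 ≤ f p) (h1 : ∀ p, f p ≤ ind b p) : |φ f| ≤ κ := by
  have h2 : Tendsto (fun n : ℕ => κ + (2 / 3 : ℝ) ^ n * ‖φ‖) atTop (𝓝 (κ + 0 * ‖φ‖)) :=
    ((tendsto_pow_atTop_nhds_zero_of_lt_one (by norm_num) (by norm_num)).mul_const _).const_add _
  rw [zero_mul, add_zero] at h2
  exact ge_of_tendsto' h2 fun n => small_pos_aux φ hb hκ n f h0 h1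

theorem small_signed (φ : C(K, ℝ) →L[ℝ] ℝ) {b : Set K} (hb : IsClopen b) {κ : ℝ}
    (hκ : ∀ c, IsClopen c → c ⊆ b → |φ (ind c)| ≤ κ)
    (f : C(K, ℝ)) (h1 : ∀ p, |f p| ≤ ind b p) : |φ f| ≤ 2 * κ := by
  let u : C(K, ℝ) := ⟨fun p => max (f p) 0, by fun_prop⟩
  let v : C(K, ℝ) := ⟨fun p => max (-f p) 0, by fun_prop⟩
  have hf : f = u - v := by
    ext p
    change f p = max (f p) 0 - max (-f p) 0
    rcases le_total 0 (f p) with h | h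
    · rw [max_eq_left h, max_eq_right (by linarith)]; ring
    · rw [max_eq_right h, max_eq_left (by linarith)]; ring
  have hu := small_pos φ hb hκ u (fun p => le_max_right _ _)
    (fun p => max_le ((le_abs_self _).trans (h1 p)) (ind_nonneg hb p))
  have hv := small_pos φ hb hκ v (fun p => le_max_right _ _)
    (fun p => max_le ((neg_le_abs _).trans (h1 p)) (ind_nonneg hb p))
  rw [hf, map_sub]
  have := abs_sub (φ u) (φ v)
  linarith

variable [MeasurableSpace K] [BorelSpace K]

theorem integrable_cm (L : Measure K) [IsFiniteMeasure L] {f : K → ℝ} (hf : Continuous f) :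
    Integrable f L := by
  obtain ⟨C, hC⟩ := isCompact_univ.exists_bound_of_continuousOn hf.continuousOn
  exact Integrable.of_bound (μ := L) hf.aestronglyMeasurable C
    (Eventually.of_forall fun x => hC x (mem_univ x))

/-- domination of all off-diagonal functionals -/
def OffDom (ι : X → K) (T : C(K, ℝ) →L[ℝ] C(K, ℝ)) (L : Measure K) (ε C : ℝ) : Prop :=
  ∀ (f : C(K, ℝ)) (x : X), |ph ι T x f| ≤ C * ∫ p, |f p| ∂L + ε * ‖f‖

theorem star (h : Intf ι) (T : C(K, ℝ) →L[ℝ] C(K, ℝ)) (L : Measure K) [IsFiniteMeasure L]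
    (hL : ∀ ε > 0, ∃ η > 0, ∀ b, IsClopen b → L.real b ≤ η → ∀ x, |ph ι T x (ind b)| ≤ ε)
    {ε : ℝ} (hε : 0 < ε) : ∃ C, 0 ≤ C ∧ OffDom ι T L ε C := by
  obtain ⟨η, hη, hηL⟩ := hL (ε / 4) (by positivity)
  set B := 2 * ‖T‖ with hB
  have hB0 : 0 ≤ B := by positivity
  set τ := ε / (4 * (B + 1)) with hτ
  have hτ0 : 0 < τ := by positivity
  have hBτ : B * (2 * τ) ≤ ε / 2 := by
    have : (B + 1) * (2 * τ) = ε / 2 := by rw [hτ]; field_simp; ring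
    nlinarith
  have hC0 : 0 ≤ B / (η * τ) := by positivity
  refine ⟨B / (η * τ), hC0, ?_⟩
  have hone : ∀ (f : C(K, ℝ)) (x : X), ‖f‖ ≤ 1 →
      |ph ι T x f| ≤ B / (η * τ) * ∫ p, |f p| ∂L + ε := by
    intro f x hf
    have hint : Integrable (fun p => |f p|) L := integrable_cm L f.continuous.abs
    have hI0 : 0 ≤ ∫ p, |f p| ∂L := integral_nonneg fun p => abs_nonneg _
    rcases le_or_gt (∫ p, |f p| ∂L) (η * τ) with hcase | hcase
    · obtain ⟨b, hb, hb1, hb2⟩ := clopen_between (C := {y | 2 * τ ≤ |f y|})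
        (U := {y | τ < |f y|})
        (isClosed_le continuous_const f.continuous.abs)
        (isOpen_lt continuous_const f.continuous.abs)
        (fun y (hy : 2 * τ ≤ _) => by
          change τ < _
          linarith)
      have h1 : τ * L.real b ≤ ∫ p, |f p| ∂L := by
        rw [← integral_ind L hb, ← integral_const_mul]
        refine integral_mono ((integrable_cm L (ind b).continuous.abs).const_mul _) hint ?_
        intro p
        simp only
        rw [abs_of_nonneg (ind_nonneg hb p)]
        by_cases hp : p ∈ b
        · rw [ind_mem hb hp]
          have : τ < |f p| := hb2 hp
          linarith
        · rw [ind_not_mem hb hp]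
          simp
      have h2 : L.real b ≤ η := by
        by_contra hcon
        push Not at hcon
        nlinarith
      have h3 : ∀ c, IsClopen c → c ⊆ b → |ph ι T x (ind c)| ≤ ε / 4 := fun c hc hcb =>
        hηL c hc ((measureReal_mono hcb (measure_ne_top _ _)).trans h2) x
      have hfp : ∀ p, |f p| ≤ 1 := fun p => (f.norm_coe_le_norm p).trans hf
      have h4 := small_signed (ph ι T x) hb h3 (f * ind b) (fun p => by
        rw [ContinuousMap.mul_apply, abs_mul, abs_of_nonneg (ind_nonneg hb p)]
        exact mul_le_of_le_one_left (ind_nonneg hb p) (hfp p))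
      have h5 : ‖f - f * ind b‖ ≤ 2 * τ := by
        rw [ContinuousMap.norm_le _ (by positivity)]
        intro p
        rw [ContinuousMap.sub_apply, ContinuousMap.mul_apply, Real.norm_eq_abs]
        by_cases hp : p ∈ b
        · rw [ind_mem hb hp]
          simp only [mul_one, sub_self, abs_zero]
          positivity
        · rw [ind_not_mem hb hp]
          have : ¬ 2 * τ ≤ |f p| := fun h => hp (hb1 h)
          rw [mul_zero, sub_zero]
          linarith
      have h6 := ph_le h T x (f - f * ind b)
      have h7 : 2 * ‖T‖ * ‖f - f * ind b‖ ≤ B * (2 * τ) := mul_le_mul_of_nonneg_left h5 hB0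
      have h8 : ph ι T x f = ph ι T x (f * ind b) + ph ι T x (f - f * ind b) := by
        rw [← map_add]; congr 1; abel
      have h9 := abs_add_le (ph ι T x (f * ind b)) (ph ι T x (f - f * ind b))
      have h10 : 0 ≤ B / (η * τ) * ∫ p, |f p| ∂L := mul_nonneg hC0 hI0
      rw [h8]
      linarith
    · have h1 := ph_le h T x f
      have h2 : B * ‖f‖ ≤ B * 1 := mul_le_mul_of_nonneg_left hf hB0
      have h3 : B / (η * τ) * (η * τ) = B := by field_simp
      have h4 : B / (η * τ) * (η * τ) ≤ B / (η * τ) * ∫ p, |f p| ∂L :=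
        mul_le_mul_of_nonneg_left hcase.le hC0
      linarith
  intro f x
  rcases eq_or_ne f 0 with rfl | hf
  · simp
  have hn : 0 < ‖f‖ := norm_pos_iff.2 hf
  have h1 := hone (‖f‖⁻¹ • f) x (by
    rw [norm_smul, norm_inv, norm_norm, inv_mul_cancel₀ hn.ne'])
  have h2 : ∫ p, |(‖f‖⁻¹ • f) p| ∂L = ‖f‖⁻¹ * ∫ p, |f p| ∂L := by
    rw [← integral_const_mul]
    congr 1
    funext p
    rw [ContinuousMap.smul_apply, smul_eq_mul, abs_mul, abs_of_pos (inv_pos.2 hn)]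
  rw [h2, map_smul, smul_eq_mul, abs_mul, abs_of_pos (inv_pos.2 hn)] at h1
  have h3 := mul_le_mul_of_nonneg_left h1 hn.le
  have h4 : ‖f‖ * (‖f‖⁻¹ * |ph ι T x f|) = |ph ι T x f| := by field_simp
  have h5 : ‖f‖ * (B / (η * τ) * (‖f‖⁻¹ * ∫ p, |f p| ∂L) + ε) =
      B / (η * τ) * ∫ p, |f p| ∂L + ε * ‖f‖ := by field_simp
  rw [h4, h5] at h3
  exact h3

theorem extend (h : Intf ι) (T : C(K, ℝ) →L[ℝ] C(K, ℝ)) (L : Measure K) {δ : ℝ}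
    (hδ : {x | gd ι T x < δ}.Finite) (p : K) (hp : p ∉ ι '' {x | gd ι T x < δ}) :
    ∃ γ, δ ≤ γ ∧ ∀ ε C, OffDom ι T L ε C → ∀ f : C(K, ℝ),
      |T f p - γ * f p| ≤ C * ∫ p, |f p| ∂L + ε * ‖f‖ := by
  have hne : (comap ι (𝓝 p) ⊓ 𝓟 {x | gd ι T x < δ}ᶜ).NeBot := by
    rw [inf_principal_neBot_iff]
    intro s hs
    obtain ⟨t, ht, hts⟩ := mem_comap.1 hs
    have h1 : (ι '' {x | gd ι T x < δ})ᶜ ∈ 𝓝 p := (hδ.image ι).isClosed.isOpen_compl.mem_nhds hp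
    obtain ⟨q, hq1, ⟨x, rfl⟩⟩ := mem_closure_iff_nhds.1 (h.dense p) _ (inter_mem ht h1)
    exact ⟨x, hts hq1.1, fun hx => hq1.2 ⟨x, hx, rfl⟩⟩
  let U := Ultrafilter.of (comap ι (𝓝 p) ⊓ 𝓟 {x | gd ι T x < δ}ᶜ)
  have hU := Ultrafilter.of_le (comap ι (𝓝 p) ⊓ 𝓟 {x | gd ι T x < δ}ᶜ)
  have hU1 : Tendsto ι U (𝓝 p) := tendsto_iff_comap.2 (hU.trans inf_le_left)
  have hU2 : ∀ᶠ x in (U : Filter X), δ ≤ gd ι T x := by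
    have h1 : {x | gd ι T x < δ}ᶜ ∈ (U : Filter X) := hU.trans inf_le_right (mem_principal_self _)
    filter_upwards [h1] with x hx
    exact not_lt.1 hx
  obtain ⟨γ, -, hγ⟩ := (isCompact_Icc (a := -‖T‖) (b := ‖T‖)).ultrafilter_le_nhds
    (U.map (gd ι T)) (by
      rw [le_principal_iff]
      exact Eventually.of_forall (f := (U : Filter X)) fun x => abs_le.1 (gd_le h T x))
  have hγ' : Tendsto (gd ι T) U (𝓝 γ) := hγ
  refine ⟨γ, ge_of_tendsto hγ' hU2, fun ε C hV f => ?_⟩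
  have h1 : Tendsto (fun x => |T f (ι x) - gd ι T x * f (ι x)|) U (𝓝 |T f p - γ * f p|) :=
    ((((T f).continuous.tendsto p).comp hU1).sub
      (hγ'.mul ((f.continuous.tendsto p).comp hU1))).abs
  exact le_of_tendsto' h1 fun x => hV f x

end

end CKInj

namespace CKInj

open Filter Topology Set MeasureTheory

theorem diag_subseq {I : Type} [Countable I] (u : ℕ → I → ℝ) (B : I → ℝ)
    (hu : ∀ n i, |u n i| ≤ B i) :
    ∃ φ : ℕ → ℕ, StrictMono φ ∧ ∀ i, ∃ l, Tendsto (fun n => u (φ n) i) atTop (𝓝 l) := by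
  have hc : IsCompact (Set.pi univ fun i => Icc (-B i) (B i)) :=
    isCompact_univ_pi fun i => isCompact_Icc
  obtain ⟨a, -, φ, hφ, ha⟩ := hc.tendsto_subseq (x := u) fun n i _ => abs_le.1 (hu n i)
  exact ⟨φ, hφ, fun i => ⟨a i, (tendsto_pi_nhds.1 ha) i⟩⟩

section

variable {K : Type} [TopologicalSpace K] [CompactSpace K] [T2Space K] [TotallyDisconnectedSpace K]
  {X : Type} {ι : X → K} [MeasurableSpace K] [BorelSpace K]

theorem core_null (L : Measure K) [IsFiniteMeasure L] (ψ : C(K, ℝ) →L[ℝ] ℝ)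
    (hψ : ∀ ε > 0, ∃ C, 0 ≤ C ∧ ∀ f : C(K, ℝ), |ψ f| ≤ C * ∫ p, |f p| ∂L + ε * ‖f‖)
    (d : ℕ → C(K, ℝ)) {R : ℝ} (hR : 0 ≤ R) (hd : ∀ k, ‖d k‖ ≤ R)
    (hw : ∀ j, Tendsto (fun k => ∫ p, d j p * d k p ∂L) atTop (𝓝 0)) {r : ℝ} (hr : 0 < r)
    (hψd : ∀ k, r ≤ ψ (d k)) : False := by
  set Λ := L.real univ with hΛ
  have hΛ0 : 0 ≤ Λ := measureReal_nonneg
  set M := R ^ 2 * Λ with hM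
  have hM0 : 0 ≤ M := by positivity
  have hI : ∀ u v : C(K, ℝ), Integrable (fun p => u p * v p) L := fun u v =>
    integrable_cm L (u.continuous.mul v.continuous)
  have hdd : ∀ k, ∫ p, d k p * d k p ∂L ≤ M := by
    intro k
    have h1 : ∫ p, d k p * d k p ∂L ≤ ∫ p, R ^ 2 ∂L := by
      refine integral_mono (hI _ _) (integrable_const _) fun p => ?_
      have h2 : |d k p| ≤ R := ((d k).norm_coe_le_norm p).trans (hd k)
      simp only
      nlinarith [abs_le.1 h2]
    rw [integral_const, smul_eq_mul] at h1
    rw [hM]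
    linarith
  have key : ∀ N : ℕ, ∃ v : C(K, ℝ), ∫ p, v p * v p ∂L ≤ N * (M + 1) ∧ ‖v‖ ≤ R * N ∧
      r * N ≤ ψ v ∧ Tendsto (fun k => ∫ p, v p * d k p ∂L) atTop (𝓝 0) := by
    intro N
    induction N with
    | zero => exact ⟨0, by simp, by simp, by simp, by simp⟩
    | succ N ih =>
      obtain ⟨v, h1, h2, h3, h4⟩ := ih
      have h5 : ∀ᶠ k in atTop, |∫ p, v p * d k p ∂L| < 1 / 2 := by
        have := h4.abs
        rw [abs_zero] at this
        exact this.eventually (gt_mem_nhds (by norm_num))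
      obtain ⟨k, hk⟩ := h5.exists
      refine ⟨v + d k, ?_, ?_, ?_, ?_⟩
      · have h6 : ∫ p, (v + d k) p * (v + d k) p ∂L =
            ∫ p, v p * v p ∂L + 2 * ∫ p, v p * d k p ∂L + ∫ p, d k p * d k p ∂L := by
          rw [← integral_const_mul, ← integral_add (hI _ _) ((hI _ _).const_mul _),
            ← integral_add (f := fun p => v p * v p + 2 * (v p * d k p))
              ((hI _ _).add ((hI _ _).const_mul _)) (hI _ _)]
          congr 1
          funext p
          simp only [ContinuousMap.add_apply]
          ring
        rw [h6]
        push_cast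
        linarith [hdd k, (abs_lt.1 hk).2]
      · push_cast
        linarith [norm_add_le v (d k), hd k]
      · rw [map_add]
        push_cast
        linarith [hψd k]
      · have h6 : ∀ i, ∫ p, (v + d k) p * d i p ∂L =
            ∫ p, v p * d i p ∂L + ∫ p, d k p * d i p ∂L := by
          intro i
          rw [← integral_add (hI _ _) (hI _ _)]
          congr 1
          funext p
          simp only [ContinuousMap.add_apply]
          ring
        simp only [h6]
        simpa using h4.add (hw k)
  obtain ⟨C, hC0, hC⟩ := hψ (r / (2 * (R + 1))) (by positivity)
  obtain ⟨n, hn⟩ := exists_nat_gt (C * (M + 1 + Λ) / r)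
  have hn0 : (0 : ℝ) < n := lt_of_le_of_lt (by positivity) hn
  rw [div_lt_iff₀ hr] at hn
  obtain ⟨v, h1, h2, h3, -⟩ := key (n ^ 2)
  push_cast at h1 h2 h3
  have h4 : ∫ p, |v p| ∂L ≤ ∫ p, ((1 / (2 * n) : ℝ) * (v p * v p) + n / 2) ∂L := by
    refine integral_mono (integrable_cm L v.continuous.abs)
      (((hI v v).const_mul _).add (integrable_const _)) fun p => ?_
    simp only
    rw [← sub_nonneg]
    have : (1 / (2 * n) : ℝ) * (v p * v p) + n / 2 - |v p| = (|v p| - n) ^ 2 / (2 * n) := by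
      rw [← abs_mul_abs_self (v p)]
      field_simp
      ring
    rw [this]
    positivity
  rw [integral_add ((hI v v).const_mul _) (integrable_const _), integral_const_mul,
    integral_const, smul_eq_mul, ← hΛ] at h4
  have h5 : (1 / (2 * n) : ℝ) * ∫ p, v p * v p ∂L ≤ n * (M + 1) / 2 := by
    have := mul_le_mul_of_nonneg_left h1 (show (0 : ℝ) ≤ 1 / (2 * n) by positivity)
    have h6 : (1 / (2 * n) : ℝ) * (n ^ 2 * (M + 1)) = n * (M + 1) / 2 := by field_simp
    linarith
  have h6 := (le_abs_self _).trans (hC v)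
  have h7 : r / (2 * (R + 1)) * ‖v‖ ≤ r / 2 * n ^ 2 := by
    have h8 : r / (2 * (R + 1)) * ‖v‖ ≤ r / (2 * (R + 1)) * (R * n ^ 2) :=
      mul_le_mul_of_nonneg_left h2 (by positivity)
    have h9 : r / (2 * (R + 1)) * (R * n ^ 2) ≤ r / (2 * (R + 1)) * ((R + 1) * n ^ 2) := by
      apply mul_le_mul_of_nonneg_left _ (by positivity)
      nlinarith [sq_nonneg (n : ℝ)]
    have h10 : r / (2 * (R + 1)) * ((R + 1) * n ^ 2) = r / 2 * n ^ 2 := by field_simp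
    linarith
  have h8 : C * ∫ p, |v p| ∂L ≤ C * (n * (M + 1 + Λ) / 2) :=
    mul_le_mul_of_nonneg_left (by linarith) hC0
  have h9 : C * (n * (M + 1 + Λ) / 2) = n * (C * (M + 1 + Λ)) / 2 := by ring
  nlinarith

theorem core_cauchy (L : Measure K) [IsFiniteMeasure L] (ψ : C(K, ℝ) →L[ℝ] ℝ)
    (hψ : ∀ ε > 0, ∃ C, 0 ≤ C ∧ ∀ f : C(K, ℝ), |ψ f| ≤ C * ∫ p, |f p| ∂L + ε * ‖f‖)
    (f : ℕ → C(K, ℝ)) {R : ℝ} (hR : 0 ≤ R) (hf : ∀ k, ‖f k‖ ≤ R)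
    (hw : ∀ j, ∃ l, Tendsto (fun k => ∫ p, f j p * f k p ∂L) atTop (𝓝 l)) :
    CauchySeq fun n => ψ (f n) := by
  have hI : ∀ u v : C(K, ℝ), Integrable (fun p => u p * v p) L := fun u v =>
    integrable_cm L (u.continuous.mul v.continuous)
  by_contra hcon
  rw [Metric.cauchySeq_iff] at hcon
  push Not at hcon
  obtain ⟨r, hr, hcon⟩ := hcon
  have hcon' : ∀ N, ∃ n m, N ≤ n ∧ N ≤ m ∧ r ≤ ψ (f n - f m) := by
    intro N
    obtain ⟨n, hn, m, hm, hnm⟩ := hcon N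
    rw [Real.dist_eq] at hnm
    rcases le_abs.1 hnm with h1 | h1
    · exact ⟨n, m, hn, hm, by rw [map_sub]; exact h1⟩
    · exact ⟨m, n, hm, hn, by rw [map_sub]; linarith⟩
  choose n m hn hm hnm using hcon'
  have hnt : Tendsto n atTop atTop := tendsto_atTop_mono hn tendsto_id
  have hmt : Tendsto m atTop atTop := tendsto_atTop_mono hm tendsto_id
  have hw' : ∀ j, Tendsto (fun k => ∫ p, f j p * (f (n k) - f (m k)) p ∂L) atTop (𝓝 0) := by
    intro j
    obtain ⟨l, hl⟩ := hw j
    have h1 := (hl.comp hnt).sub (hl.comp hmt)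
    rw [sub_self] at h1
    refine h1.congr fun k => ?_
    simp only [Function.comp]
    rw [← integral_sub (hI _ _) (hI _ _)]
    congr 1
    funext p
    simp only [ContinuousMap.sub_apply]
    ring
  refine core_null L ψ hψ (fun k => f (n k) - f (m k)) (R := 2 * R) (by positivity) (fun k => ?_)
    (fun j => ?_) hr hnm
  · have := norm_sub_le (f (n k)) (f (m k))
    linarith [hf (n k), hf (m k)]
  · have h1 := (hw' (n j)).sub (hw' (m j))
    rw [sub_self] at h1
    refine h1.congr fun k => ?_
    rw [← integral_sub (hI _ _) (hI _ _)]
    congr 1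
    funext p
    simp only [ContinuousMap.sub_apply]
    ring

theorem pr_of_gd (h : Intf ι) (T : C(K, ℝ) →L[ℝ] C(K, ℝ)) {δ : ℝ} (hδ0 : 0 < δ)
    (hδ : {x | gd ι T x < δ}.Finite) : Pr T := by
  rintro f ⟨R, hfR⟩ ⟨y, hy⟩
  have hR : 0 ≤ R := (norm_nonneg _).trans (hfR 0)
  obtain ⟨L, hLfin, hL⟩ := exists_ctrl h T
  have hstar : ∀ ε > 0, ∃ C, 0 ≤ C ∧ OffDom ι T L ε C := fun ε hε => star h T L hL hε
  have hcF : Countable {x | gd ι T x < δ} := hδ.countable.to_subtype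
  obtain ⟨φ, hφ, hlim⟩ := diag_subseq
    (I := ℕ ⊕ {x | gd ι T x < δ})
    (fun n i => Sum.elim (fun m => ∫ p, f m p * f n p ∂L) (fun x => f n (ι x)) i)
    (Sum.elim (fun _ => R ^ 2 * L.real univ) (fun _ => R)) (by
      rintro n (m | x)
      · simp only [Sum.elim_inl]
        have := norm_integral_le_of_norm_le_const (μ := L) (f := fun p => f m p * f n p)
          (C := R ^ 2) (Eventually.of_forall fun p => by
            rw [norm_mul, sq]
            exact mul_le_mul (((f m).norm_coe_le_norm p).trans (hfR m))
              (((f n).norm_coe_le_norm p).trans (hfR n)) (norm_nonneg _) hR)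
        exact this
      · exact ((f n).norm_coe_le_norm _).trans (hfR n))
  have hlim1 : ∀ m, ∃ l, Tendsto (fun n => ∫ p, f m p * f (φ n) p ∂L) atTop (𝓝 l) :=
    fun m => hlim (Sum.inl m)
  have hlim2 : ∀ x, gd ι T x < δ → ∃ l, Tendsto (fun n => f (φ n) (ι x)) atTop (𝓝 l) :=
    fun x hx => hlim (Sum.inr ⟨x, hx⟩)
  have hTy : Tendsto (fun n => T (f (φ n))) atTop (𝓝 y) := hy.comp hφ.tendsto_atTop
  have hpt : ∀ p, ∃ l, Tendsto (fun n => f (φ n) p) atTop (𝓝 l) := by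
    intro p
    by_cases hp : p ∈ ι '' {x | gd ι T x < δ}
    · obtain ⟨x, hx, rfl⟩ := hp
      exact hlim2 x hx
    obtain ⟨γ, hγ, hγ2⟩ := extend h T L hδ p hp
    have hγ0 : γ ≠ 0 := (lt_of_lt_of_le hδ0 hγ).ne'
    let ψ : C(K, ℝ) →L[ℝ] ℝ := (ContinuousMap.evalCLM ℝ p).comp T - γ • ContinuousMap.evalCLM ℝ p
    have hψ : ∀ u, ψ u = T u p - γ * u p := fun u => rfl
    have hc := core_cauchy L ψ (fun ε hε => by
      obtain ⟨C, hC0, hC⟩ := hstar ε hε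
      exact ⟨C, hC0, fun u => hγ2 ε C hC u⟩) (fun n => f (φ n)) hR (fun n => hfR _)
      (fun m => hlim1 (φ m))
    obtain ⟨l, hl⟩ := cauchySeq_tendsto_of_complete hc
    have h1 : Tendsto (fun n => T (f (φ n)) p) atTop (𝓝 (y p)) :=
      ((ContinuousMap.evalCLM ℝ p : C(K, ℝ) →L[ℝ] ℝ).continuous.tendsto y).comp hTy
    have h2 := (h1.sub hl).div_const γ
    refine ⟨_, h2.congr fun n => ?_⟩
    rw [hψ]
    field_simp
    ring
  choose G hG using hpt
  have hGm : Measurable G := measurable_of_tendsto_metrizable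
    (fun n => (f (φ n)).continuous.measurable) (tendsto_pi_nhds.2 hG)
  have hGb : ∀ p, |G p| ≤ R := fun p => le_of_tendsto' (hG p).abs fun n =>
    ((f (φ n)).norm_coe_le_norm p).trans (hfR _)
  have hint : ∀ n, Integrable (fun p => |f (φ n) p - G p|) L := fun n =>
    ((integrable_cm L (f (φ n)).continuous).sub
      (Integrable.of_bound hGm.aestronglyMeasurable R (Eventually.of_forall hGb))).abs
  have hL1 : Tendsto (fun n => ∫ p, |f (φ n) p - G p| ∂L) atTop (𝓝 0) := by
    have := tendsto_integral_of_dominated_convergence (μ := L)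
      (F := fun n p => |f (φ n) p - G p|) (f := fun _ => (0 : ℝ)) (fun _ => 2 * R)
      (fun n => (hint n).aestronglyMeasurable) (integrable_const _)
      (fun n => Eventually.of_forall fun p => by
        rw [Real.norm_eq_abs, abs_abs]
        have h1 : |f (φ n) p| ≤ R := ((f (φ n)).norm_coe_le_norm p).trans (hfR _)
        have h2 := abs_sub (f (φ n) p) (G p)
        linarith [hGb p])
      (Eventually.of_forall fun p => by
        have := ((hG p).sub_const (G p)).abs
        simpa using this)
    simpa using this
  refine ⟨φ, hφ, cauchySeq_tendsto_of_complete ?_⟩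
  rw [Metric.cauchySeq_iff]
  intro ε hε
  obtain ⟨C, hC0, hC⟩ := hstar (δ * ε / (8 * (R + 1))) (by positivity)
  have e1 : ∀ᶠ n in atTop, ∀ x ∈ {x | gd ι T x < δ}, |f (φ n) (ι x) - G (ι x)| < ε / 4 := by
    rw [eventually_all_finite hδ]
    intro x _
    have := ((hG (ι x)).sub_const (G (ι x))).abs
    rw [sub_self, abs_zero] at this
    exact this.eventually (gt_mem_nhds (by positivity))
  have e2 : ∀ᶠ n in atTop, ∫ p, |f (φ n) p - G p| ∂L < δ * ε / (8 * (C + 1)) :=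
    hL1.eventually (gt_mem_nhds (by positivity))
  have e3 : ∀ᶠ n in atTop, ‖T (f (φ n)) - y‖ < δ * ε / 8 := by
    have := (tendsto_iff_norm_sub_tendsto_zero.1 hTy)
    exact this.eventually (gt_mem_nhds (by positivity))
  obtain ⟨N, hN⟩ := eventually_atTop.1 (e1.and (e2.and e3))
  refine ⟨N, fun n hn m hm => ?_⟩
  obtain ⟨a1, a2, a3⟩ := hN n hn
  obtain ⟨b1, b2, b3⟩ := hN m hm
  rw [dist_eq_norm]
  refine lt_of_le_of_lt (norm_le_of_dense h _ (show 0 ≤ 3 / 4 * ε by positivity) fun x => ?_)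
    (by linarith)
  simp only [Function.comp]
  by_cases hx : gd ι T x < δ
  · have h1 := abs_lt.1 (a1 x hx)
    have h2 := abs_lt.1 (b1 x hx)
    rw [ContinuousMap.sub_apply, abs_le]
    constructor <;> linarith [h1.1, h1.2, h2.1, h2.2]
  set u := f (φ n) - f (φ m) with hu
  have h1 := hC u x
  rw [ph_apply] at h1
  have h2 : |T u (ι x)| ≤ δ * ε / 4 := by
    refine ((T u).norm_coe_le_norm _).trans ?_
    have : T u = (T (f (φ n)) - y) - (T (f (φ m)) - y) := by
      rw [hu, map_sub]; abel
    rw [this]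
    linarith [norm_sub_le (T (f (φ n)) - y) (T (f (φ m)) - y)]
  have h3 : ∫ p, |u p| ∂L ≤ δ * ε / (4 * (C + 1)) := by
    have h4 : ∫ p, |u p| ∂L ≤ ∫ p, (|f (φ n) p - G p| + |f (φ m) p - G p|) ∂L := by
      refine integral_mono (integrable_cm L u.continuous.abs) ((hint n).add (hint m)) fun p => ?_
      simp only [hu, ContinuousMap.sub_apply]
      rw [abs_sub_comm (f (φ m) p) (G p)]
      exact abs_sub_le _ _ _
    rw [integral_add (hint n) (hint m)] at h4
    have h5 : δ * ε / (8 * (C + 1)) + δ * ε / (8 * (C + 1)) = δ * ε / (4 * (C + 1)) := by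
      field_simp; ring
    linarith
  have h4 : C * ∫ p, |u p| ∂L ≤ δ * ε / 4 := by
    have h5 : C * ∫ p, |u p| ∂L ≤ (C + 1) * (δ * ε / (4 * (C + 1))) :=
      mul_le_mul (by linarith) h3 (integral_nonneg fun p => abs_nonneg _) (by positivity)
    have h6 : (C + 1) * (δ * ε / (4 * (C + 1))) = δ * ε / 4 := by field_simp
    linarith
  have h5 : δ * ε / (8 * (R + 1)) * ‖u‖ ≤ δ * ε / 4 := by
    have h6 : ‖u‖ ≤ 2 * (R + 1) := by
      have := norm_sub_le (f (φ n)) (f (φ m))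
      linarith [hfR (φ n), hfR (φ m)]
    have h7 := mul_le_mul_of_nonneg_left h6 (show 0 ≤ δ * ε / (8 * (R + 1)) by positivity)
    have h8 : δ * ε / (8 * (R + 1)) * (2 * (R + 1)) = δ * ε / 4 := by field_simp; ring
    linarith
  have h6 : |gd ι T x * u (ι x)| ≤ 3 / 4 * (δ * ε) := by
    rw [abs_le] at h1 h2 ⊢
    constructor <;> linarith [h1.1, h1.2, h2.1, h2.2]
  rw [abs_mul, abs_of_nonneg (by linarith)] at h6
  have h7 : δ * |u (ι x)| ≤ gd ι T x * |u (ι x)| :=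
    mul_le_mul_of_nonneg_right (not_lt.1 hx) (abs_nonneg _)
  have h8 : δ * |u (ι x)| ≤ δ * (3 / 4 * ε) := by linarith
  exact le_of_mul_le_mul_left h8 hδ0

theorem surj_of_inj (h : Intf ι) (T : C(K, ℝ) →L[ℝ] C(K, ℝ)) (hT : Function.Injective T) :
    Function.Surjective T := by
  have h2 : Function.Surjective (T.comp T) := by
    refine path_surj (hT.comp hT) fun s hs => ?_
    obtain ⟨δ, hδ, hfin⟩ := lemma1_sq h T hT
    refine pr_of_gd h _ hδ (hfin.subset fun x hx => ?_)
    have h1 : gd ι (T.comp T + s • ContinuousLinearMap.id ℝ C(K, ℝ)) x =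
        gd ι (T.comp T) x + s := by
      have h3 := ind_mem (h.clopen_pt x) (x := ι x) rfl
      simp [gd, h3]
    simp only [mem_setOf_eq] at hx ⊢
    rw [h1] at hx
    linarith
  intro y
  obtain ⟨u, hu⟩ := h2 y
  exact ⟨T u, hu⟩

theorem not_finDim (h : Intf ι) : ¬ FiniteDimensional ℝ C(K, ℝ) := by
  intro hfd
  have hX := h.infX
  have hli : LinearIndependent ℝ fun x : X => (ind {ι x} : C(K, ℝ)) := by
    rw [linearIndependent_iff']
    intro s g hg i hi
    have h1 := congrArg (fun f : C(K, ℝ) => f (ι i)) hg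
    simp only [ContinuousMap.sum_apply, ContinuousMap.smul_apply, ContinuousMap.zero_apply] at h1
    rw [Finset.sum_eq_single i] at h1
    · rw [ind_mem (h.clopen_pt i) rfl] at h1
      simpa using h1
    · intro j _ hji
      rw [ind_not_mem (h.clopen_pt j) (fun e => hji (h.inj e).symm)]
      simp
    · intro hcon
      exact absurd hi hcon
  exact not_finite_iff_infinite.2 hX hli.finite

end

end CKInj


/-- There exists an infinite-dimensional real Banach space of the form `C(K)`,
`K` compact Hausdorff, on which every injective bounded linear operator is surjective. -/
theorem exists_CK_injective_implies_surjective :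
    ∃ (K : Type) (_ : TopologicalSpace K) (_ : CompactSpace K) (_ : T2Space K),
      ¬ FiniteDimensional ℝ C(K, ℝ) ∧
      ∀ T : C(K, ℝ) →L[ℝ] C(K, ℝ), Function.Injective T → Function.Surjective T := by
  obtain ⟨K, X, tK, cK, t2K, tdK, ι, h⟩ := CKInj.exists_intf
  letI : MeasurableSpace K := borel K
  haveI : BorelSpace K := ⟨rfl⟩
  exact ⟨K, tK, cK, t2K, CKInj.not_finDim h, fun T hT => CKInj.surj_of_inj h T hT⟩
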